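/- arXiv:2408.04346 — 2 statements merged into one kernel-verified Lean document; each statement's English description precedes it below -/
import Mathlib

section
/- Let n ≥ 4. Then for every t ≥ 0, μ_{SO(n)}( max_{ij} Θ(O)_ij ≥ t √(log(n)/n) ) ≤ (8/(t√(2π))) n^{−t²/8 + 2}, and for every t ≥ √40, μ_{SO(n)}( max_{ij} Θ(O)_ij ≥ t √(log(n)/n) ) ≤ (8/(t√(2π))) n^{−3}. -/
open MeasureTheory Matrix Real

instance matrixMeasurableSpace {n : ℕ} : MeasurableSpace (Matrix (Fin n) (Fin n) ℝ) :=
  (inferInstance : MeasurableSpace (Fin n → Fin n → ℝ))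

/-- Membership in the special orthogonal group `SO(n)`. -/
def IsSO {n : ℕ} (O : Matrix (Fin n) (Fin n) ℝ) : Prop :=
  O.transpose * O = 1 ∧ O.det = 1

/-- `μ` is the Haar probability measure on `SO(n)` (viewed as a measure on matrices):
it is a probability measure, supported on `SO(n)`, and invariant under left translation
by elements of `SO(n)`. -/
structure IsHaarSO {n : ℕ} (μ : Measure (Matrix (Fin n) (Fin n) ℝ)) : Prop where
  prob : IsProbabilityMeasure μ
  supp : ∀ᵐ O ∂μ, IsSO O
  inv : ∀ U : Matrix (Fin n) (Fin n) ℝ, IsSO U → Measure.map (fun O => U * O) μ = μ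

/-- The symmetric weight matrix `Θ(O)` with `Θ_ij = √((O_ij² + O_ji²)/2)`. -/
noncomputable def weight {n : ℕ} (O : Matrix (Fin n) (Fin n) ℝ) :
    Matrix (Fin n) (Fin n) ℝ :=
  Matrix.of fun i j => Real.sqrt ((O i j ^ 2 + O j i ^ 2) / 2)

/-- Plane rotation by angle `θ` in the coordinates `i`, `k`. -/
noncomputable def planeRot {n : ℕ} (i k : Fin n) (θ : ℝ) : Matrix (Fin n) (Fin n) ℝ :=
  Matrix.of fun a b =>
    if a = i then Real.cos θ * (1 : Matrix (Fin n) (Fin n) ℝ) i b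
        + Real.sin θ * (1 : Matrix (Fin n) (Fin n) ℝ) k b
    else if a = k then -Real.sin θ * (1 : Matrix (Fin n) (Fin n) ℝ) i b
        + Real.cos θ * (1 : Matrix (Fin n) (Fin n) ℝ) k b
    else (1 : Matrix (Fin n) (Fin n) ℝ) a b

lemma planeRot_mul_apply {n : ℕ} (i k : Fin n) (θ : ℝ) (M : Matrix (Fin n) (Fin n) ℝ)
    (a b : Fin n) :
    (planeRot i k θ * M) a b =
      if a = i then Real.cos θ * M i b + Real.sin θ * M k b
      else if a = k then -Real.sin θ * M i b + Real.cos θ * M k b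
      else M a b := by
  have h1 : ∀ (c s : ℝ) (p q : Fin n),
      ∑ x, (c * (1 : Matrix (Fin n) (Fin n) ℝ) p x + s * (1 : Matrix (Fin n) (Fin n) ℝ) q x)
        * M x b = c * M p b + s * M q b := by
    intro c s p q
    simp only [add_mul, Finset.sum_add_distrib, mul_assoc, ← Finset.mul_sum]
    simp [Matrix.one_apply]
  rw [Matrix.mul_apply]
  unfold planeRot
  simp only [Matrix.of_apply]
  split_ifs
  · exact h1 _ _ _ _
  · exact h1 _ _ _ _
  · simp [Matrix.one_apply]

lemma planeRot_add {n : ℕ} {i k : Fin n} (hik : i ≠ k) (θ φ : ℝ) :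
    planeRot i k θ * planeRot i k φ = planeRot i k (θ + φ) := by
  ext a b
  rw [planeRot_mul_apply]
  simp only [planeRot, Matrix.of_apply, hik.symm, if_true, if_false, Real.cos_add, Real.sin_add]
  split_ifs <;> ring

lemma planeRot_zero {n : ℕ} (i k : Fin n) : planeRot i k 0 = 1 := by
  ext a b
  simp only [planeRot, Matrix.of_apply, Real.cos_zero, Real.sin_zero]
  split_ifs with h h'
  · subst h; simp
  · subst h'; simp
  · rfl

lemma planeRot_transpose {n : ℕ} {i k : Fin n} (hik : i ≠ k) (θ : ℝ) :
    (planeRot i k θ).transpose = planeRot i k (-θ) := by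
  ext a b
  simp only [planeRot, Matrix.transpose_apply, Matrix.of_apply, Real.cos_neg, Real.sin_neg,
    Matrix.one_apply]
  have := hik.symm
  by_cases h1 : a = i <;> by_cases h2 : a = k <;> by_cases h3 : b = i <;> by_cases h4 : b = k <;>
    simp_all [eq_comm]

lemma planeRot_isSO {n : ℕ} {i k : Fin n} (hik : i ≠ k) (θ : ℝ) : IsSO (planeRot i k θ) := by
  have h1 : (planeRot i k θ).transpose * planeRot i k θ = 1 := by
    rw [planeRot_transpose hik, planeRot_add hik, neg_add_cancel, planeRot_zero]
  refine ⟨h1, ?_⟩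
  have h2 : (planeRot i k θ).det * (planeRot i k θ).det = 1 := by
    have := congrArg Matrix.det h1
    rwa [Matrix.det_mul, Matrix.det_transpose, Matrix.det_one] at this
  have h3 : (planeRot i k θ).det = (planeRot i k (θ/2)).det * (planeRot i k (θ/2)).det := by
    rw [← Matrix.det_mul, planeRot_add hik, add_halves]
  have h4 : 0 ≤ (planeRot i k θ).det := by rw [h3]; exact mul_self_nonneg _
  nlinarith

lemma measurable_entry {n : ℕ} (i j : Fin n) :
    Measurable (fun O : Matrix (Fin n) (Fin n) ℝ => O i j) := by
  have h : Measurable (fun O : Fin n → Fin n → ℝ => O i j) := by fun_prop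
  exact h

lemma measurable_leftMul {n : ℕ} (U : Matrix (Fin n) (Fin n) ℝ) :
    Measurable (fun O : Matrix (Fin n) (Fin n) ℝ => U * O) := by
  refine measurable_pi_lambda _ fun a => measurable_pi_lambda _ fun b => ?_
  simp only [Matrix.mul_apply]
  exact Finset.measurable_sum _ fun x _ => (measurable_entry x b).const_mul _

lemma IsSO.col_sq {n : ℕ} {O : Matrix (Fin n) (Fin n) ℝ} (h : IsSO O) (j : Fin n) :
    ∑ k, O k j ^ 2 = 1 := by
  have := congrFun (congrFun h.1 j) j
  simpa [Matrix.mul_apply, sq] using this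

lemma IsSO.sq_le {n : ℕ} {O : Matrix (Fin n) (Fin n) ℝ} (h : IsSO O) (i j : Fin n) :
    O i j ^ 2 ≤ 1 := by
  rw [← h.col_sq j]
  exact Finset.single_le_sum (f := fun k => O k j ^ 2) (fun _ _ => sq_nonneg _) (Finset.mem_univ i)

/-- The derivative kernel. -/
noncomputable def kern (l y z : ℝ) : ℝ :=
  (1 + 2 * l * y ^ 2) * Real.exp (l * y ^ 2) * z ^ 2 - y ^ 2 * Real.exp (l * y ^ 2)

lemma kern_bound {l y z : ℝ} (hl : 0 ≤ l) (hy : y ^ 2 ≤ 2) (hz : z ^ 2 ≤ 2) :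
    ‖kern l y z‖ ≤ (1 + 2 * l * 2) * Real.exp (l * 2) * 2 + 2 * Real.exp (l * 2) := by
  unfold kern
  refine (norm_sub_le _ _).trans ?_
  have he : Real.exp (l * y ^ 2) ≤ Real.exp (l * 2) := by gcongr
  rw [Real.norm_of_nonneg (by positivity), Real.norm_of_nonneg (by positivity)]
  gcongr

lemma kern_hasDerivAt (l a b θ : ℝ) :
    HasDerivAt (fun θ => ((Real.cos θ * a + Real.sin θ * b)
        * Real.exp (l * (Real.cos θ * a + Real.sin θ * b) ^ 2))
        * (-Real.sin θ * a + Real.cos θ * b))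
      (kern l (Real.cos θ * a + Real.sin θ * b) (-Real.sin θ * a + Real.cos θ * b)) θ := by
  have hy : HasDerivAt (fun θ => Real.cos θ * a + Real.sin θ * b)
      (-Real.sin θ * a + Real.cos θ * b) θ :=
    ((Real.hasDerivAt_cos θ).mul_const a).add ((Real.hasDerivAt_sin θ).mul_const b)
  have hz : HasDerivAt (fun θ => -Real.sin θ * a + Real.cos θ * b)
      (-Real.cos θ * a + -Real.sin θ * b) θ :=
    ((Real.hasDerivAt_sin θ).neg.mul_const a).add ((Real.hasDerivAt_cos θ).mul_const b)
  have := (hy.mul ((hy.pow 2).const_mul l).exp).mul hz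
  refine this.congr_deriv ?_
  simp only [kern, Pi.mul_apply, Pi.pow_apply]
  push_cast
  ring

lemma kern_integral {n : ℕ} (μ : Measure (Matrix (Fin n) (Fin n) ℝ)) (hH : IsHaarSO μ)
    {l : ℝ} (hl : 0 ≤ l) {i k : Fin n} (hik : i ≠ k) (j : Fin n) :
    Integrable (fun O => kern l (O i j) (O k j)) μ ∧ ∫ O, kern l (O i j) (O k j) ∂μ = 0 := by
  have := hH.prob
  set f : Matrix (Fin n) (Fin n) ℝ → ℝ :=
    fun O => (O i j * Real.exp (l * (O i j) ^ 2)) * O k j with hf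
  have mi := measurable_entry i j
  have mk := measurable_entry k j
  have mf : Measurable f := by fun_prop
  have hconst : ∀ θ, ∫ O, f (planeRot i k θ * O) ∂μ = ∫ O, f O ∂μ := by
    intro θ
    conv_rhs => rw [← hH.inv _ (planeRot_isSO hik θ)]
    rw [integral_map (measurable_leftMul _).aemeasurable mf.aestronglyMeasurable]
  have hfe : ∀ θ O, f (planeRot i k θ * O) = ((Real.cos θ * O i j + Real.sin θ * O k j)
        * Real.exp (l * (Real.cos θ * O i j + Real.sin θ * O k j) ^ 2))
        * (-Real.sin θ * O i j + Real.cos θ * O k j) := by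
    intro θ O
    simp only [hf, planeRot_mul_apply, hik.symm, if_true, if_false]
  have hint : Integrable f μ := by
    refine Integrable.of_bound mf.aestronglyMeasurable (Real.exp l) ?_
    filter_upwards [hH.supp] with O hO
    have h1 := hO.sq_le i j
    have h2 := hO.sq_le k j
    have a1 : |O i j| ≤ 1 := by rwa [sq_le_one_iff_abs_le_one] at h1
    have a2 : |O k j| ≤ 1 := by rwa [sq_le_one_iff_abs_le_one] at h2
    simp only [hf, norm_mul, Real.norm_eq_abs, Real.abs_exp]
    calc |O i j| * Real.exp (l * O i j ^ 2) * |O k j| ≤ 1 * Real.exp (l * 1) * 1 := by gcongr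
      _ = _ := by ring_nf
  have hf0 : (fun O => f (planeRot i k 0 * O)) = f := by
    funext O; rw [planeRot_zero, one_mul]
  have key := hasDerivAt_integral_of_dominated_loc_of_deriv_le (μ := μ) (𝕜 := ℝ)
    (F := fun θ O => f (planeRot i k θ * O))
    (F' := fun θ O => kern l (Real.cos θ * O i j + Real.sin θ * O k j)
      (-Real.sin θ * O i j + Real.cos θ * O k j)) (x₀ := 0) (s := Set.univ)
    (bound := fun _ => (1 + 2 * l * 2) * Real.exp (l * 2) * 2 + 2 * Real.exp (l * 2))
    Filter.univ_mem
    (Filter.Eventually.of_forall fun θ => (mf.comp (measurable_leftMul _)).aestronglyMeasurable)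
    (by rw [hf0]; exact hint)
    (by
      have : Measurable fun O : Matrix (Fin n) (Fin n) ℝ =>
        kern l (Real.cos 0 * O i j + Real.sin 0 * O k j)
          (-Real.sin 0 * O i j + Real.cos 0 * O k j) := by
        unfold kern; fun_prop
      exact this.aestronglyMeasurable)
    (by
      filter_upwards [hH.supp] with O hO θ _
      have h1 := hO.sq_le i j
      have h2 := hO.sq_le k j
      have hsum : (Real.cos θ * O i j + Real.sin θ * O k j) ^ 2
          + (-Real.sin θ * O i j + Real.cos θ * O k j) ^ 2 = O i j ^ 2 + O k j ^ 2 := by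
        linear_combination (O i j ^ 2 + O k j ^ 2) * Real.sin_sq_add_cos_sq θ
      apply kern_bound hl
      · nlinarith [sq_nonneg (-Real.sin θ * O i j + Real.cos θ * O k j)]
      · nlinarith [sq_nonneg (Real.cos θ * O i j + Real.sin θ * O k j)])
    (integrable_const _)
    (by
      refine Filter.Eventually.of_forall fun O θ _ => ?_
      simp only [hfe]
      exact kern_hasDerivAt l _ _ θ)
  simp only [Real.cos_zero, Real.sin_zero, one_mul, zero_mul, add_zero, neg_zero, zero_add] at key
  refine ⟨key.1, ?_⟩
  have h2 := key.2
  simp only [hconst] at h2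
  exact h2.unique (hasDerivAt_const _ _)

lemma exp_moment {n : ℕ} (hn : 4 ≤ n) (μ : Measure (Matrix (Fin n) (Fin n) ℝ)) (hH : IsHaarSO μ)
    (i j : Fin n) :
    Integrable (fun O => Real.exp ((n : ℝ) / 4 * O i j ^ 2)) μ ∧
      ∫ O, Real.exp ((n : ℝ) / 4 * O i j ^ 2) ∂μ ≤ 2 := by
  have := hH.prob
  set l : ℝ := (n : ℝ) / 4 with hl
  have hl0 : 0 ≤ l := by positivity
  have mi := measurable_entry i j
  have hint : Integrable (fun O : Matrix (Fin n) (Fin n) ℝ => Real.exp (l * O i j ^ 2)) μ := by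
    refine Integrable.of_bound (Measurable.aestronglyMeasurable (by fun_prop)) (Real.exp l) ?_
    filter_upwards [hH.supp] with O hO
    have h1 := hO.sq_le i j
    rw [Real.norm_eq_abs, Real.abs_exp]
    gcongr
    nlinarith
  refine ⟨hint, ?_⟩
  have hk : ∀ k ∈ Finset.univ.erase i, Integrable (fun O => kern l (O i j) (O k j)) μ ∧
      ∫ O, kern l (O i j) (O k j) ∂μ = 0 := fun k hk =>
    kern_integral μ hH hl0 (Finset.ne_of_mem_erase hk).symm j
  have hsum : ∫ O, ∑ k ∈ Finset.univ.erase i, kern l (O i j) (O k j) ∂μ = 0 := by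
    rw [integral_finsetSum _ fun k h => (hk k h).1]
    exact Finset.sum_eq_zero fun k h => (hk k h).2
  have hsi : Integrable (fun O => ∑ k ∈ Finset.univ.erase i, kern l (O i j) (O k j)) μ :=
    integrable_finsetSum _ fun k h => (hk k h).1
  have hle : ∫ O, Real.exp (l * O i j ^ 2) ∂μ ≤
      ∫ O, (2 - ∑ k ∈ Finset.univ.erase i, kern l (O i j) (O k j)) ∂μ := by
    apply integral_mono_ae hint ((integrable_const _).sub hsi)
    filter_upwards [hH.supp] with O hO
    have hcol := hO.col_sq j
    rw [← Finset.add_sum_erase _ _ (Finset.mem_univ i)] at hcol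
    have h1 := hO.sq_le i j
    have hs : ∑ k ∈ Finset.univ.erase i, kern l (O i j) (O k j) =
        (1 + 2 * l * O i j ^ 2) * Real.exp (l * O i j ^ 2) * (1 - O i j ^ 2)
          - (n - 1) * (O i j ^ 2 * Real.exp (l * O i j ^ 2)) := by
      simp only [kern, Finset.sum_sub_distrib, ← Finset.mul_sum, Finset.sum_const, nsmul_eq_mul]
      rw [Finset.card_erase_of_mem (Finset.mem_univ i), Finset.card_univ, Fintype.card_fin,
        Nat.cast_sub (by omega), eq_sub_of_add_eq' hcol]
      push_cast
      ring
    simp only [Pi.sub_apply]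
    rw [hs]
    have hn4 : (n : ℝ) = 4 * l := by rw [hl]; ring
    rw [hn4]
    have hE : Real.exp (l * O i j ^ 2) * (1 - l * O i j ^ 2) ≤ 1 := by
      have h := Real.add_one_le_exp (-(l * O i j ^ 2))
      calc Real.exp (l * O i j ^ 2) * (1 - l * O i j ^ 2)
          ≤ Real.exp (l * O i j ^ 2) * Real.exp (-(l * O i j ^ 2)) := by
            gcongr; linarith
        _ = 1 := by rw [← Real.exp_add]; simp
    have hE' : 0 ≤ l * (O i j ^ 2) ^ 2 * Real.exp (l * O i j ^ 2) := by positivity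
    linarith
  rw [integral_sub (integrable_const _) hsi, hsum] at hle
  simpa using hle

lemma entry_tail {n : ℕ} (hn : 4 ≤ n) (μ : Measure (Matrix (Fin n) (Fin n) ℝ)) (hH : IsHaarSO μ)
    (i j : Fin n) {s : ℝ} (hs : 0 ≤ s) :
    μ {O | s ≤ |O i j|} ≤ ENNReal.ofReal (2 * Real.exp (-((n : ℝ) / 4 * s ^ 2))) := by
  have := hH.prob
  obtain ⟨h1, h2⟩ := exp_moment hn μ hH i j
  have h3 := mul_meas_ge_le_integral_of_nonneg (μ := μ)
    (Filter.Eventually.of_forall fun O => (Real.exp_pos _).le) h1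
    (Real.exp ((n : ℝ) / 4 * s ^ 2))
  have hsub : {O : Matrix (Fin n) (Fin n) ℝ | s ≤ |O i j|} ⊆
      {O | Real.exp ((n : ℝ) / 4 * s ^ 2) ≤ Real.exp ((n : ℝ) / 4 * O i j ^ 2)} := by
    intro O hO
    simp only [Set.mem_ofPred_eq] at hO ⊢
    rw [← sq_abs (O i j)]
    gcongr
  refine (measure_mono hsub).trans ?_
  rw [← ofReal_measureReal]
  apply ENNReal.ofReal_le_ofReal
  rw [Real.exp_neg, ← div_eq_mul_inv, le_div_iff₀ (Real.exp_pos _), mul_comm]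
  exact h3.trans h2

lemma max_tail {n : ℕ} (hn : 4 ≤ n) (μ : Measure (Matrix (Fin n) (Fin n) ℝ)) (hH : IsHaarSO μ)
    {s : ℝ} (hs : 0 ≤ s) :
    μ {O | s ≤ ⨆ i : Fin n, ⨆ j : Fin n, weight O i j} ≤
      ENNReal.ofReal ((n : ℝ) ^ 2 * (2 * Real.exp (-((n : ℝ) / 4 * s ^ 2)))) := by
  have : Nonempty (Fin n) := ⟨⟨0, by omega⟩⟩
  have hsub : {O : Matrix (Fin n) (Fin n) ℝ | s ≤ ⨆ i : Fin n, ⨆ j : Fin n, weight O i j} ⊆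
      ⋃ i : Fin n, ⋃ j : Fin n, {O | s ≤ |O i j|} := by
    intro O hO
    simp only [Set.mem_ofPred_eq, Set.mem_iUnion] at hO ⊢
    obtain ⟨i, hi⟩ := exists_eq_ciSup_of_finite (f := fun i : Fin n => ⨆ j : Fin n, weight O i j)
    obtain ⟨j, hj⟩ := exists_eq_ciSup_of_finite (f := fun j : Fin n => weight O i j)
    have hO2 : s ≤ weight O i j := hO.trans (hi.symm.trans hj.symm).le
    clear hO
    have hO : s ≤ Real.sqrt ((O i j ^ 2 + O j i ^ 2) / 2) := hO2
    rw [Real.le_sqrt hs (by positivity)] at hO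
    by_contra hcon
    push Not at hcon
    have a1 := hcon i j
    have a2 := hcon j i
    have b1 := pow_lt_pow_left₀ a1 (abs_nonneg _) two_ne_zero
    have b2 := pow_lt_pow_left₀ a2 (abs_nonneg _) two_ne_zero
    rw [sq_abs] at b1 b2
    linarith
  calc _ ≤ _ := measure_mono hsub
    _ ≤ ∑ i : Fin n, μ (⋃ j : Fin n, {O | s ≤ |O i j|}) := measure_iUnion_fintype_le _ _
    _ ≤ ∑ i : Fin n, ∑ j : Fin n, μ {O | s ≤ |O i j|} :=
        Finset.sum_le_sum fun i _ => measure_iUnion_fintype_le _ _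
    _ ≤ ∑ i : Fin n, ∑ j : Fin n, ENNReal.ofReal (2 * Real.exp (-((n : ℝ) / 4 * s ^ 2))) :=
        Finset.sum_le_sum fun i _ => Finset.sum_le_sum fun j _ => entry_tail hn μ hH i j hs
    _ = _ := by
        rw [ENNReal.ofReal_mul (p := (n : ℝ) ^ 2) (by positivity), ENNReal.ofReal_pow (by positivity),
          ENNReal.ofReal_natCast]
        simp [sq, mul_assoc]

/-- Lemma 2.6: tail bounds for the maximal entry of the weight matrix `Θ(O)` under the
Haar measure on `SO(n)`.  The bound `8/(t√(2π))` is interpreted in `ℝ≥0∞` so that it is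
`∞` for `t = 0`. -/
theorem tails_max_weight {n : ℕ} (hn : 4 ≤ n)
    (μSO : Measure (Matrix (Fin n) (Fin n) ℝ)) (hHaar : IsHaarSO μSO) :
    (∀ t : ℝ, 0 ≤ t →
      μSO {O | t * Real.sqrt (Real.log n / n) ≤ ⨆ i : Fin n, ⨆ j : Fin n, weight O i j} ≤
        (ENNReal.ofReal 8 / ENNReal.ofReal (t * Real.sqrt (2 * π))) *
          ENNReal.ofReal ((n : ℝ) ^ (-t ^ 2 / 8 + 2))) ∧
    (∀ t : ℝ, Real.sqrt 40 ≤ t →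
      μSO {O | t * Real.sqrt (Real.log n / n) ≤ ⨆ i : Fin n, ⨆ j : Fin n, weight O i j} ≤
        (ENNReal.ofReal 8 / ENNReal.ofReal (t * Real.sqrt (2 * π))) *
          ENNReal.ofReal ((n : ℝ) ^ (-(3 : ℝ)))) := by
  have hn0 : (0 : ℝ) < n := by positivity
  have hn1 : (1 : ℝ) ≤ n := by exact_mod_cast (by omega : 1 ≤ n)
  have hL : 1 ≤ Real.log n := by
    rw [Real.le_log_iff_exp_le hn0]
    have h4 : (4 : ℝ) ≤ n := by exact_mod_cast hn
    linarith [Real.exp_one_lt_d9]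
  have first : ∀ t : ℝ, 0 ≤ t →
      μSO {O | t * Real.sqrt (Real.log n / n) ≤ ⨆ i : Fin n, ⨆ j : Fin n, weight O i j} ≤
        (ENNReal.ofReal 8 / ENNReal.ofReal (t * Real.sqrt (2 * π))) *
          ENNReal.ofReal ((n : ℝ) ^ (-t ^ 2 / 8 + 2)) := by
    intro t ht
    have hpow : 0 < (n : ℝ) ^ (-t ^ 2 / 8 + 2) := Real.rpow_pos_of_pos hn0 _
    rcases ht.eq_or_lt with rfl | ht
    · rw [zero_mul (Real.sqrt (2 * π)), ENNReal.ofReal_zero, ENNReal.div_zero (by simp), ENNReal.top_mul]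
      · exact le_top
      · exact (ENNReal.ofReal_pos.mpr hpow).ne'
    have hp : 0 < Real.sqrt (2 * π) := by positivity
    refine (max_tail hn μSO hHaar (by positivity)).trans ?_
    rw [← ENNReal.ofReal_div_of_pos (by positivity), ← ENNReal.ofReal_mul (by positivity)]
    apply ENNReal.ofReal_le_ofReal
    have e1 : (n : ℝ) / 4 * (t * Real.sqrt (Real.log n / n)) ^ 2 = t ^ 2 * Real.log n / 4 := by
      rw [mul_pow, Real.sq_sqrt (by positivity)]
      field_simp
    have e2 : (n : ℝ) ^ (-t ^ 2 / 8 + 2) = (n : ℝ) ^ 2 * Real.exp (-(t ^ 2 * Real.log n / 8)) := by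
      rw [Real.rpow_add hn0, Real.rpow_two, Real.rpow_def_of_pos hn0, mul_comm]
      congr 2
      ring
    have e3 : Real.exp (-(t ^ 2 * Real.log n / 4)) =
        Real.exp (-(t ^ 2 * Real.log n / 8)) * Real.exp (-(t ^ 2 * Real.log n / 8)) := by
      rw [← Real.exp_add]; congr 1; ring
    have hs : Real.sqrt (2 * π) ≤ 2.6 := by
      rw [Real.sqrt_le_left (by norm_num)]
      nlinarith [Real.pi_lt_d2]
    have key : 2 * Real.exp (-(t ^ 2 * Real.log n / 8)) ≤ 8 / (t * Real.sqrt (2 * π)) := by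
      rw [Real.exp_neg, ← div_eq_mul_inv, div_le_div_iff₀ (Real.exp_pos _) (by positivity)]
      have h1 := Real.add_one_le_exp (t ^ 2 * Real.log n / 8)
      have h2 : t ^ 2 ≤ t ^ 2 * Real.log n := le_mul_of_one_le_right (by positivity) hL
      have h3 : t * Real.sqrt (2 * π) ≤ t * 2.6 := by gcongr
      nlinarith [sq_nonneg (t - 2.6)]
    rw [e1, e2, e3]
    calc (n : ℝ) ^ 2 * (2 * (Real.exp (-(t ^ 2 * Real.log n / 8)) *
          Real.exp (-(t ^ 2 * Real.log n / 8))))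
        = (2 * Real.exp (-(t ^ 2 * Real.log n / 8))) *
          ((n : ℝ) ^ 2 * Real.exp (-(t ^ 2 * Real.log n / 8))) := by ring
      _ ≤ _ := by gcongr
  refine ⟨first, fun t ht => ?_⟩
  have ht0 : 0 ≤ t := (Real.sqrt_nonneg _).trans ht
  refine (first t ht0).trans ?_
  gcongr
  have h40 : (40 : ℝ) ≤ t ^ 2 := by
    rwa [Real.sqrt_le_left ht0] at ht
  linarith
end

section
/- Let p ≥ 2 be real, q = p/(p−1), and let f be a smooth function defined in a neighbourhood of S_p^{n−1} in ℝⁿ. Then for n > q, Ent_{μ_{p,n}}(|f|^q) ≤ 4^q q^{q−1} ( Γ((n−q)/p) / (p^{q/p} Γ(n/p)) ) ∫_{S_p^{n−1}} |∇f(θ)|_q^q dμ_{p,n}, where ∇f is the usual (Euclidean) gradient in the ambient space ℝⁿ; moreover, for every n ≥ 3 the prefactor satisfies 4^q q^{q−1} Γ((n−q)/p)/(p^{q/p} Γ(n/p)) ≤ 3 · 4^q q^{q−1} n^{−1/(p−1)}. -/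
open MeasureTheory Real

/-- The `ℓ_p`-norm on `ℝⁿ`. -/
noncomputable def lpNorm (p : ℝ) {n : ℕ} (x : Fin n → ℝ) : ℝ :=
  (∑ i, |x i| ^ p) ^ (1 / p)

/-- The cone probability measure `μ_{p,n}` on the `ℓ_p`-sphere: the pushforward of the
normalized Lebesgue measure on the `ℓ_p`-unit ball under radial projection `x ↦ x/|x|_p`. -/
noncomputable def coneMeasure (p : ℝ) (n : ℕ) : Measure (Fin n → ℝ) :=
  Measure.map (fun x => (lpNorm p x)⁻¹ • x)
    ((volume {x : Fin n → ℝ | lpNorm p x ≤ 1})⁻¹ •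
      volume.restrict {x : Fin n → ℝ | lpNorm p x ≤ 1})

/-- The entropy functional `Ent_μ(g) = ∫ g log g dμ - (∫ g dμ) log(∫ g dμ)`. -/
noncomputable def entropy {α : Type*} [MeasurableSpace α] (μ : Measure α) (g : α → ℝ) : ℝ :=
  (∫ x, g x * Real.log (g x) ∂μ) - (∫ x, g x ∂μ) * Real.log (∫ x, g x ∂μ)

theorem aux_gamma (p : ℝ) (hp : 2 ≤ p) (q : ℝ) (hq : q = p / (p - 1))
    (n : ℕ) (hn : q < (n : ℝ)) (h3 : 3 ≤ n) :
    4 ^ q * q ^ (q - 1) *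
          (Real.Gamma (((n : ℝ) - q) / p) / (p ^ (q / p) * Real.Gamma ((n : ℝ) / p))) ≤
        3 * 4 ^ q * q ^ (q - 1) * (n : ℝ) ^ (-(1 / (p - 1))) := by
  have hp1 : 0 < p - 1 := by linarith
  have hq0 : 0 < q := by rw [hq]; positivity
  have hq2 : q ≤ 2 := by rw [hq, div_le_iff₀ hp1]; linarith
  have hn3 : (3 : ℝ) ≤ n := by exact_mod_cast h3
  set a := 1 / (p - 1) with ha
  have ha0 : 0 < a := by positivity
  have ha1 : a ≤ 1 := by rw [ha, div_le_one hp1]; linarith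
  have hqp : q / p = a := by rw [hq, ha]; field_simp
  set x := (n : ℝ) / p with hx
  have hx0 : 0 < x := by positivity
  have hxa : ((n : ℝ) - q) / p = x - a := by rw [sub_div, hqp]
  have hxa0 : 0 < x - a := by rw [← hxa]; apply div_pos <;> linarith
  rw [hxa, hqp]
  have hG : Real.Gamma (x + 1 - a) ≤ Real.Gamma x * x ^ (1 - a) := by
    rcases ha1.lt_or_eq with h | h
    · have := Real.Gamma_mul_add_mul_le_rpow_Gamma_mul_rpow_Gamma hx0 (by linarith : 0 < x + 1)
        ha0 (by linarith : 0 < 1 - a) (by ring)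
      rw [show a * x + (1 - a) * (x + 1) = x + 1 - a by ring, Real.Gamma_add_one hx0.ne',
        Real.mul_rpow hx0.le (Real.Gamma_pos_of_pos hx0).le] at this
      calc _ ≤ _ := this
        _ = (Real.Gamma x ^ a * Real.Gamma x ^ (1 - a)) * x ^ (1 - a) := by ring
        _ = _ := by
          rw [← Real.rpow_add (Real.Gamma_pos_of_pos hx0)]; simp
    · rw [h]; simp
  have hG2 : Real.Gamma (x - a) * (x - a) ≤ Real.Gamma x * x ^ (1 - a) := by
    rw [mul_comm (Real.Gamma (x - a)), ← Real.Gamma_add_one hxa0.ne']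
    convert hG using 2; ring
  have hGx := Real.Gamma_pos_of_pos hx0
  have hratio : x ≤ 3 * (x - a) := by
    rw [← hxa, hx, mul_div_assoc', div_le_div_iff_of_pos_right (by linarith)]; linarith
  have hna : (n : ℝ) ^ (-a) = x ^ (-a) * p ^ (-a) := by
    rw [← Real.mul_rpow hx0.le (by linarith), hx]; congr 1; field_simp
  have key : Real.Gamma (x - a) / (p ^ a * Real.Gamma x) ≤ 3 * (n : ℝ) ^ (-a) := by
    have hpa : 0 < p ^ a := Real.rpow_pos_of_pos (by linarith) _
    rw [hna, Real.rpow_neg (by linarith : 0 ≤ p) a, div_le_iff₀ (by positivity)]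
    have : 3 * (x ^ (-a) * (p ^ a)⁻¹) * (p ^ a * Real.Gamma x) = 3 * x ^ (-a) * Real.Gamma x := by
      field_simp
    rw [this]
    have hxp : x ^ (1 - a) = x * x ^ (-a) := by
      rw [sub_eq_add_neg, Real.rpow_add hx0, Real.rpow_one]
    rw [hxp] at hG2
    have hxa' : 0 < x ^ (-a) := by positivity
    refine le_of_mul_le_mul_right ?_ hxa0
    calc _ ≤ _ := hG2
      _ = (Real.Gamma x * x ^ (-a)) * x := by ring
      _ ≤ (Real.Gamma x * x ^ (-a)) * (3 * (x - a)) := by gcongr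
      _ = _ := by ring
  calc _ ≤ 4 ^ q * q ^ (q - 1) * (3 * (n : ℝ) ^ (-a)) := by gcongr
    _ = _ := by ring

theorem aux_pconv (p : ℝ) (hp : 2 ≤ p) (x y : ℝ) :
    |x| ^ p + p * |x| ^ (p - 2) * x * (y - x) + 2 * (|y - x| / 2) ^ p ≤ |y| ^ p := by
  have hsq : ∀ a : ℝ, |a| ^ p = (a ^ 2) ^ (p / 2) := by
    intro a
    rw [← sq_abs, ← Real.rpow_natCast, ← Real.rpow_mul (abs_nonneg a)]
    congr 1; push_cast; ring
  have hcl : |(x + y) / 2| ^ p + |(y - x) / 2| ^ p ≤ (|x| ^ p + |y| ^ p) / 2 := by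
    rw [hsq, hsq, hsq x, hsq y]
    have h1 := Real.add_rpow_le_rpow_add (p := p / 2) (sq_nonneg ((x + y) / 2)) (sq_nonneg ((y - x) / 2)) (by linarith)
    refine h1.trans ?_
    have h2 := (convexOn_rpow (by linarith : (1 : ℝ) ≤ p / 2)).2 (sq_nonneg x : x ^ 2 ∈ Set.Ici (0:ℝ)) (sq_nonneg y : y ^ 2 ∈ Set.Ici (0:ℝ))
      (by norm_num : (0 : ℝ) ≤ 1 / 2) (by norm_num : (0 : ℝ) ≤ 1 / 2) (by norm_num)
    simp only [smul_eq_mul] at h2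
    calc _ = (1 / 2 * x ^ 2 + 1 / 2 * y ^ 2) ^ (p / 2) := by congr 1; ring
      _ ≤ _ := h2
      _ = _ := by ring
  have htan : |x| ^ p + p * |x| ^ (p - 2) * x * ((x + y) / 2 - x) ≤ |(x + y) / 2| ^ p := by
    set m := (x + y) / 2
    have hxx : |x| ^ (p - 2) * x * x = |x| ^ p := by
      rw [mul_assoc, ← abs_mul_abs_self x]
      rcases eq_or_ne x 0 with rfl | h
      · simp; rw [Real.zero_rpow (by linarith)]
      · have : 0 < |x| := abs_pos.2 h
        rw [← sq, ← Real.rpow_natCast, ← Real.rpow_add this]; congr 1; push_cast; ring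
    have hxm : |x| ^ (p - 2) * x * m ≤ |x| ^ (p - 1) * |m| := by
      calc |x| ^ (p - 2) * x * m ≤ |(|x| ^ (p - 2) * x * m)| := le_abs_self _
        _ = |x| ^ (p - 2) * |x| * |m| := by
          rw [abs_mul, abs_mul, abs_of_nonneg (Real.rpow_nonneg (abs_nonneg x) _)]
        _ = _ := by
          congr 1
          rcases eq_or_ne x 0 with rfl | h
          · simp; rw [Real.zero_rpow (by linarith)]
          · have : 0 < |x| := abs_pos.2 h
            rw [← Real.rpow_add_one this.ne']; congr 1; ring
    have hconj : (p / (p - 1)).HolderConjugate p :=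
      (Real.HolderConjugate.conjExponent (by linarith : 1 < p)).symm
    have hy := Real.young_inequality_of_nonneg (Real.rpow_nonneg (abs_nonneg x) (p - 1)) (abs_nonneg m) hconj
    have : (|x| ^ (p - 1)) ^ (p / (p - 1)) = |x| ^ p := by
      rw [← Real.rpow_mul (abs_nonneg x)]; congr 1
      have : p - 1 ≠ 0 := by linarith
      field_simp
    rw [this] at hy
    have h3 : p * (|x| ^ (p - 1) * |m|) ≤ (p - 1) * |x| ^ p + |m| ^ p := by
      have h4 := mul_le_mul_of_nonneg_left hy (by linarith : 0 ≤ p)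
      have : p - 1 ≠ 0 := by linarith
      have : p * (|x| ^ p / (p / (p - 1)) + |m| ^ p / p) = (p - 1) * |x| ^ p + |m| ^ p := by
        field_simp
      linarith
    have h5 := mul_le_mul_of_nonneg_left hxm (by linarith : 0 ≤ p)
    nlinarith [hxx]
  have h6 : |(y - x) / 2| = |y - x| / 2 := by rw [abs_div]; norm_num
  rw [h6] at hcl
  nlinarith


theorem aux_conj (p : ℝ) (hp : 2 ≤ p) (q : ℝ) (hq : q = p / (p - 1)) : p.HolderConjugate q := by
  rw [hq]; exact Real.HolderConjugate.conjExponent (by linarith : 1 < p)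

theorem aux_young (p : ℝ) (hp : 2 ≤ p) (q : ℝ) (hq : q = p / (p - 1)) (a g t : ℝ) (hg : 0 < g) :
    |a| * |t| ≤ g * (2 * (|t| / 2) ^ p / p) + 2 / q * (|a| ^ q * g ^ (1 - q)) := by
  have hc := aux_conj p hp q hq
  have hq0 : 0 < q := hc.symm.pos
  have hy := Real.young_inequality_of_nonneg (a := 2 ^ (1 / q) * (|a| / g)) (b := 2 ^ (1 / p) * (|t| / 2))
    (by positivity) (by positivity) hc.symm
  rw [Real.mul_rpow (by positivity) (by positivity), Real.mul_rpow (by positivity) (by positivity),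
    ← Real.rpow_mul (by positivity), ← Real.rpow_mul (by positivity), one_div_mul_cancel hq0.ne',
    one_div_mul_cancel hc.ne_zero, Real.rpow_one] at hy
  have h1 : (2 : ℝ) ^ (1 / q) * (|a| / g) * (2 ^ (1 / p) * (|t| / 2)) = |a| * |t| / g := by
    have : (2 : ℝ) ^ (1 / q) * 2 ^ (1 / p) = 2 := by
      rw [← Real.rpow_add (by norm_num)]
      have := hc.inv_add_inv_eq_one
      rw [one_div, one_div, add_comm, this, Real.rpow_one]
    calc _ = ((2 : ℝ) ^ (1 / q) * 2 ^ (1 / p)) * (|a| * |t| / g) / 2 := by ring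
      _ = _ := by rw [this]; ring
  rw [h1, div_le_iff₀ hg, Real.div_rpow (abs_nonneg a) hg.le] at hy
  refine hy.trans (le_of_eq ?_)
  rw [Real.rpow_sub hg, Real.rpow_one]
  field_simp
  ring

theorem aux_w_deriv (p : ℝ) (hp : 2 ≤ p) (x : ℝ) :
    HasDerivAt (fun x : ℝ => exp (-(|x| ^ p / p))) (-(|x| ^ (p - 2) * x) * exp (-(|x| ^ p / p))) x := by
  have h := (((hasDerivAt_abs_rpow x (by linarith : 1 < p)).div_const p).neg).exp
  have h0 : p ≠ 0 := by linarith
  have e : -(|x| ^ (p - 2) * x) * exp (-(|x| ^ p / p)) = exp (-(|x| ^ p / p)) * -(p * |x| ^ (p - 2) * x / p) := by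
    field_simp
  rw [e]
  exact h

theorem aux_transport (w : ℝ → ℝ) (hwc : Continuous w) (c : ℝ) (hc : 0 < c) (hcw : ∀ x, c ≤ w x) (a b : ℝ)
    (hab : a ≤ b)
    (k : ℝ → ℝ) (hkc : Continuous k) (hk : ∀ x, 0 < k x)
    (h : ∫ x in a..b, k x = ∫ x in a..b, w x) :
    ∃ T : ℝ → ℝ, Continuous T ∧ T a = a ∧ T b = b ∧ (∀ x ∈ Set.Icc a b, T x ∈ Set.Icc a b) ∧
      ∀ x, HasDerivAt T (k x / w (T x)) x := by
  let Φ : ℝ → ℝ := fun x => ∫ t in a..x, w t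
  let G : ℝ → ℝ := fun x => ∫ t in a..x, k t
  have hΦ : ∀ x, HasDerivAt Φ (w x) x := fun x => hwc.integral_hasStrictDerivAt a x |>.hasDerivAt
  have hG : ∀ x, HasDerivAt G (k x) x := fun x => hkc.integral_hasStrictDerivAt a x |>.hasDerivAt
  have hmono : StrictMono Φ := strictMono_of_hasDerivAt_pos hΦ (fun x => hc.trans_le (hcw x))
  have hGmono : StrictMono G := strictMono_of_hasDerivAt_pos hG hk
  have hΦc : Continuous Φ := continuous_iff_continuousAt.2 fun x => (hΦ x).continuousAt
  have hGc : Continuous G := continuous_iff_continuousAt.2 fun x => (hG x).continuousAt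
  have hdiff : Monotone (fun x => Φ x - c * x) := by
    apply monotone_of_hasDerivAt_nonneg (f' := fun x => w x - c * 1)
    · intro x; exact (hΦ x).sub ((hasDerivAt_id x).const_mul c)
    · intro x; simp only [mul_one, Pi.zero_apply]; linarith [hcw x]
  have hsurj : Function.Surjective Φ := by
    refine hΦc.surjective ?_ ?_
    · refine Filter.tendsto_atTop_mono' _ (f₁ := fun x => c * x + (Φ 0 - c * 0)) ?_ ?_
      · filter_upwards [Filter.eventually_ge_atTop 0] with x hx
        have := hdiff hx
        simp only at this
        linarith
      · exact Filter.tendsto_atTop_add_const_right _ _ (Filter.tendsto_id.const_mul_atTop hc)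
    · refine Filter.tendsto_atBot_mono' (f₂ := Φ) (f₁ := fun x => c * x + (Φ 0 - c * 0)) _ ?_ ?_
      · filter_upwards [Filter.eventually_le_atBot 0] with x hx
        have := hdiff hx
        simp only at this
        linarith
      · exact Filter.tendsto_atBot_add_const_right _ _ (Filter.tendsto_id.const_mul_atBot hc)
  let e := hmono.orderIsoOfSurjective Φ hsurj
  have he : ∀ x, e x = Φ x := fun x => rfl
  have hTe : ∀ x, Φ (e.symm x) = x := fun x => e.apply_symm_apply x
  refine ⟨fun x => e.symm (G x), e.symm.continuous.comp hGc, ?_, ?_, ?_, ?_⟩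
  · rw [e.symm_apply_eq, he]; simp [G, Φ]
  · rw [e.symm_apply_eq, he]; exact h
  · intro x hx
    have ea : e.symm (G a) = a := by rw [e.symm_apply_eq, he]; simp [G, Φ]
    have eb : e.symm (G b) = b := by rw [e.symm_apply_eq, he]; exact h
    constructor
    · conv_lhs => rw [← ea]
      exact e.symm.monotone (hGmono.monotone hx.1)
    · conv_rhs => rw [← eb]
      exact e.symm.monotone (hGmono.monotone hx.2)
  · intro x
    have h1 : HasDerivAt e.symm (w (e.symm (G x)))⁻¹ (G x) :=
      HasDerivAt.of_local_left_inverse e.symm.continuous.continuousAt (hΦ _)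
        (hc.trans_le (hcw _)).ne' (Filter.Eventually.of_forall hTe)
    have := h1.comp x (hG x)
    rw [div_eq_inv_mul]; exact this

theorem aux_interval (p : ℝ) (hp : 2 ≤ p) (q : ℝ) (hq : q = p / (p - 1)) (g g' : ℝ → ℝ)
    (hg : ∀ x, HasDerivAt g (g' x) x) (hg' : Continuous g') (hpos : ∀ x, 0 < g x) (R : ℝ) (hR : 0 < R)
    (hnorm : ∫ x in (-R)..R, g x * exp (-(|x| ^ p / p)) = ∫ x in (-R)..R, exp (-(|x| ^ p / p))) :
    ∫ x in (-R)..R, g x * log (g x) * exp (-(|x| ^ p / p)) ≤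
      ∫ x in (-R)..R, 2 / q * (|g' x| ^ q * g x ^ (1 - q)) * exp (-(|x| ^ p / p)) := by
  have hp0 : 0 < p := by linarith
  have hq0 : 0 < q := (aux_conj p hp q hq).symm.pos
  set w : ℝ → ℝ := fun x => exp (-(|x| ^ p / p)) with hw
  have hwc : Continuous w := by
    have : Continuous (fun x : ℝ => |x| ^ p) := continuous_abs.rpow_const (fun _ => Or.inr hp0.le)
    fun_prop
  have hgc : Continuous g := continuous_iff_continuousAt.2 fun x => (hg x).continuousAt
  have hwpos : ∀ x, 0 < w x := fun x => exp_pos _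
  have hwR : ∀ x ∈ Set.Icc (-R) R, max (w x) (w R) = w x := by
    intro x hx
    apply max_eq_left
    simp only [hw]
    have h1 : |x| ≤ |R| := by rw [abs_of_pos hR]; exact abs_le.2 hx
    have h2 := Real.rpow_le_rpow (abs_nonneg x) h1 hp0.le
    exact Real.exp_le_exp.2 (neg_le_neg (div_le_div_of_nonneg_right h2 hp0.le))
  have hIcc : Set.uIcc (-R) R = Set.Icc (-R) R := Set.uIcc_of_le (by linarith)
  obtain ⟨T, hTc, hTa, hTb, hTI, hT⟩ := aux_transport (fun x => max (w x) (w R)) (by fun_prop) (w R) (hwpos R)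
    (fun x => le_max_right _ _) (-R) R (by linarith) (fun x => g x * w x) (by fun_prop)
    (fun x => mul_pos (hpos x) (hwpos x)) (by
      rw [hnorm]
      apply intervalIntegral.integral_congr
      intro x hx
      rw [hIcc] at hx
      exact (hwR x hx).symm)
  set τ : ℝ → ℝ := fun x => g x * w x / max (w (T x)) (w R) with hτ
  have hτc : Continuous τ := by
    apply Continuous.div (by fun_prop) (by fun_prop)
    intro x; exact (lt_max_of_lt_right (hwpos R)).ne'
  have hder : ∀ x, HasDerivAt (fun x => g x * w x * (T x - x))
      ((g' x * w x + g x * (-(|x| ^ (p - 2) * x) * w x)) * (T x - x) + g x * w x * (τ x - 1)) x := by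
    intro x
    exact ((hg x).mul (aux_w_deriv p hp x)).mul ((hT x).sub (hasDerivAt_id x))
  have hVc : Continuous (fun x : ℝ => |x| ^ (p - 2)) :=
    continuous_abs.rpow_const (fun _ => Or.inr (by linarith))
  have hDc : Continuous (fun x => (g' x * w x + g x * (-(|x| ^ (p - 2) * x) * w x)) * (T x - x) + g x * w x * (τ x - 1)) := by
    fun_prop
  have hint0 : ∫ x in (-R)..R, ((g' x * w x + g x * (-(|x| ^ (p - 2) * x) * w x)) * (T x - x) + g x * w x * (τ x - 1)) = 0 := by
    rw [intervalIntegral.integral_eq_sub_of_hasDerivAt (fun x _ => hder x) (hDc.intervalIntegrable _ _)]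
    simp [hTa, hTb]
  have hBc : Continuous (fun x => 2 / q * (|g' x| ^ q * g x ^ (1 - q)) * w x) := by
    have h1 : Continuous (fun x => |g' x| ^ q) := (continuous_abs.comp hg').rpow_const (fun _ => Or.inr hq0.le)
    have h2 : Continuous (fun x => g x ^ (1 - q)) := hgc.rpow_const (fun x => Or.inl (hpos x).ne')
    fun_prop
  have hLc : Continuous (fun x => g x * log (g x) * w x) :=
    (hgc.mul (hgc.log (fun x => (hpos x).ne'))).mul hwc
  have hBD : Continuous (fun x => 2 / q * (|g' x| ^ q * g x ^ (1 - q)) * w x +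
      ((g' x * w x + g x * (-(|x| ^ (p - 2) * x) * w x)) * (T x - x) + g x * w x * (τ x - 1))) := hBc.add hDc
  have := intervalIntegral.integral_mono_on (μ := volume) (a := -R) (b := R) (by linarith)
    (hLc.intervalIntegrable _ _) (hBD.intervalIntegrable _ _) (fun x hx => ?_)
  · rw [intervalIntegral.integral_add (hBc.intervalIntegrable _ _) (hDc.intervalIntegrable _ _), hint0, add_zero] at this
    exact this
  · have hTx := hwR _ (hTI x hx)
    have hτx : τ x = g x * w x / w (T x) := by simp only [hτ, hTx]
    have hτpos : 0 < τ x := by rw [hτx]; exact div_pos (mul_pos (hpos x) (hwpos x)) (hwpos _)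
    have hlog : log (τ x) = log (g x) - |x| ^ p / p + |T x| ^ p / p := by
      rw [hτx, Real.log_div (mul_pos (hpos x) (hwpos x)).ne' (hwpos _).ne', Real.log_mul (hpos x).ne' (hwpos x).ne']
      simp only [hw, Real.log_exp]; ring
    have h1 := Real.log_le_sub_one_of_pos hτpos
    have h2 := aux_pconv p hp x (T x)
    have h3 := aux_young p hp q hq (g' x) (g x) (T x - x) (hpos x)
    have h4 : -(g' x * (T x - x)) ≤ |g' x| * |T x - x| := by
      rw [← abs_mul]; exact neg_le_abs _
    have h5 : 2 * (|T x - x| / 2) ^ p / p ≤ |T x| ^ p / p - |x| ^ p / p - |x| ^ (p - 2) * x * (T x - x) := by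
      rw [div_le_iff₀ hp0]
      have : (|T x| ^ p / p - |x| ^ p / p - |x| ^ (p - 2) * x * (T x - x)) * p = |T x| ^ p - |x| ^ p - p * |x| ^ (p - 2) * x * (T x - x) := by
        field_simp
      rw [this]; linarith
    have h6 := mul_le_mul_of_nonneg_left h5 (hpos x).le
    have h7 : g x * log (g x) ≤ g x * (τ x - 1 + |x| ^ p / p - |T x| ^ p / p) := by
      apply mul_le_mul_of_nonneg_left _ (hpos x).le
      linarith
    have h8 : g x * log (g x) ≤ 2 / q * (|g' x| ^ q * g x ^ (1 - q)) + ((g' x + g x * (-(|x| ^ (p - 2) * x))) * (T x - x) + g x * (τ x - 1)) := by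
      nlinarith
    calc _ ≤ _ := mul_le_mul_of_nonneg_right h8 (hwpos x).le
      _ = _ := by ring


/-- The one dimensional weight. -/
noncomputable def wgt (p x : ℝ) : ℝ := exp (-(|x| ^ p / p))

/-- The normalising constant. -/
noncomputable def wgtZ (p : ℝ) : ℝ := ∫ y, wgt p y

/-- The one-dimensional probability measure with density proportional to the weight. -/
noncomputable def nuMeasure (p : ℝ) : Measure ℝ :=
  volume.withDensity (fun x => ENNReal.ofReal (wgt p x / wgtZ p))

theorem wgt_pos (p x : ℝ) : 0 < wgt p x := exp_pos _

theorem wgt_cont (p : ℝ) (hp : 2 ≤ p) : Continuous (wgt p) := by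
  have : Continuous (fun x : ℝ => |x| ^ p) := continuous_abs.rpow_const (fun _ => Or.inr (by linarith))
  unfold wgt
  fun_prop

theorem wgtZ_pos (p : ℝ) (hp : 2 ≤ p) : 0 < wgtZ p := by
  have h := integral_comp_abs (f := fun x : ℝ => exp (-(x ^ p / p)))
  have h2 := integral_exp_neg_mul_rpow (p := p) (b := 1 / p) (by linarith) (by positivity)
  have h3 : ∀ x : ℝ, exp (-(1 / p) * x ^ p) = exp (-(x ^ p / p)) := by
    intro x; congr 1; ring
  simp_rw [h3] at h2
  unfold wgtZ wgt
  rw [h, h2]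
  have : 0 < Real.Gamma (1 / p + 1) := Real.Gamma_pos_of_pos (by positivity)
  positivity

theorem wgt_int (p : ℝ) (hp : 2 ≤ p) : Integrable (wgt p) :=
  Integrable.of_integral_ne_zero (wgtZ_pos p hp).ne'

theorem nu_integral (p : ℝ) (hp : 2 ≤ p) (h : ℝ → ℝ) :
    ∫ x, h x ∂(nuMeasure p) = (∫ x, h x * wgt p x) / wgtZ p := by
  unfold nuMeasure
  rw [integral_withDensity_eq_integral_toReal_smul
    ((wgt_cont p hp).div_const _).measurable.ennreal_ofReal (by simp)]
  rw [← integral_div]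
  congr 1
  ext x
  rw [ENNReal.toReal_ofReal (div_nonneg (wgt_pos p x).le (wgtZ_pos p hp).le), smul_eq_mul]
  ring

theorem nu_integrable (p : ℝ) (hp : 2 ≤ p) (h : ℝ → ℝ) (hi : Integrable h (nuMeasure p)) :
    Integrable (fun x => h x * wgt p x) := by
  unfold nuMeasure at hi
  rw [integrable_withDensity_iff_integrable_smul' ((wgt_cont p hp).div_const _).measurable.ennreal_ofReal (by simp)] at hi
  have := hi.mul_const (wgtZ p)
  refine this.congr (Filter.Eventually.of_forall fun x => ?_)
  simp only
  rw [ENNReal.toReal_ofReal (div_nonneg (wgt_pos p x).le (wgtZ_pos p hp).le), smul_eq_mul]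
  have := (wgtZ_pos p hp).ne'
  field_simp

theorem nu_prob (p : ℝ) (hp : 2 ≤ p) : IsProbabilityMeasure (nuMeasure p) := by
  constructor
  unfold nuMeasure
  rw [withDensity_apply _ MeasurableSet.univ, Measure.restrict_univ,
    ← ofReal_integral_eq_lintegral_ofReal ((wgt_int p hp).div_const _)
      (Filter.Eventually.of_forall fun x => div_nonneg (wgt_pos p x).le (wgtZ_pos p hp).le), integral_div]
  change ENNReal.ofReal (wgtZ p / wgtZ p) = 1
  rw [div_self (wgtZ_pos p hp).ne']; simp

theorem aux_interval' (p : ℝ) (hp : 2 ≤ p) (q : ℝ) (hq : q = p / (p - 1)) (g g' : ℝ → ℝ)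
    (hg : ∀ x, HasDerivAt g (g' x) x) (hg' : Continuous g') (hpos : ∀ x, 0 < g x) (R : ℝ) (hR : 0 < R) :
    (∫ x in (-R)..R, g x * log (g x) * wgt p x) - (∫ x in (-R)..R, g x * wgt p x) *
      log ((∫ x in (-R)..R, g x * wgt p x) / (∫ x in (-R)..R, wgt p x)) ≤
      ∫ x in (-R)..R, 2 / q * (|g' x| ^ q * g x ^ (1 - q)) * wgt p x := by
  have hwc := wgt_cont p hp
  have hgc : Continuous g := continuous_iff_continuousAt.2 fun x => (hg x).continuousAt
  have hI : 0 < ∫ x in (-R)..R, g x * wgt p x :=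
    intervalIntegral.intervalIntegral_pos_of_pos_on ((hgc.mul hwc).intervalIntegrable _ _)
      (fun x _ => mul_pos (hpos x) (wgt_pos p x)) (by linarith)
  have hJ : 0 < ∫ x in (-R)..R, wgt p x :=
    intervalIntegral.intervalIntegral_pos_of_pos_on (hwc.intervalIntegrable _ _)
      (fun x _ => (wgt_pos p x)) (by linarith)
  set I := ∫ x in (-R)..R, g x * wgt p x with hIdef
  set J := ∫ x in (-R)..R, wgt p x with hJdef
  set a := I / J with ha
  have ha0 : 0 < a := div_pos hI hJ
  have key := aux_interval p hp q hq (fun x => g x / a) (fun x => g' x / a) (fun x => (hg x).div_const a)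
    (hg'.div_const a) (fun x => div_pos (hpos x) ha0) R hR (by
      have : ∀ x, g x / a * exp (-(|x| ^ p / p)) = (g x * wgt p x) / a := by
        intro x; unfold wgt; ring
      simp_rw [this]
      rw [intervalIntegral.integral_div, ← hIdef, ha]
      change _ = J
      field_simp)
  have e1 : ∀ x, g x / a * log (g x / a) * exp (-(|x| ^ p / p)) =
      (g x * log (g x) * wgt p x) / a - (log a / a) * (g x * wgt p x) := by
    intro x
    rw [Real.log_div (hpos x).ne' ha0.ne']; unfold wgt; ring
  have e2 : ∀ x, 2 / q * (|g' x / a| ^ q * (g x / a) ^ (1 - q)) * exp (-(|x| ^ p / p)) =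
      (2 / q * (|g' x| ^ q * g x ^ (1 - q)) * wgt p x) / a := by
    intro x
    rw [abs_div, abs_of_pos ha0, Real.div_rpow (abs_nonneg _) ha0.le, Real.div_rpow (hpos x).le ha0.le,
      Real.rpow_sub ha0, Real.rpow_one]
    have : 0 < a ^ q := by positivity
    unfold wgt
    field_simp
  simp_rw [e1, e2] at key
  have hLc : Continuous (fun x => g x * log (g x) * wgt p x) :=
    (hgc.mul (hgc.log (fun x => (hpos x).ne'))).mul hwc
  have hgwc : Continuous (fun x => g x * wgt p x) := hgc.mul hwc
  rw [intervalIntegral.integral_sub ((hLc.div_const a).intervalIntegrable _ _)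
    ((hgwc.const_mul _).intervalIntegrable _ _), intervalIntegral.integral_div,
    intervalIntegral.integral_div, intervalIntegral.integral_const_mul, ← hIdef] at key
  have := mul_le_mul_of_nonneg_left key ha0.le
  rw [mul_sub, mul_div_cancel₀ _ ha0.ne', mul_div_cancel₀ _ ha0.ne'] at this
  calc _ = _ := ?_
    _ ≤ _ := this
  field_simp

theorem aux_real (p : ℝ) (hp : 2 ≤ p) (q : ℝ) (hq : q = p / (p - 1)) (g g' : ℝ → ℝ)
    (hg : ∀ x, HasDerivAt g (g' x) x) (hg' : Continuous g') (ε M : ℝ) (hε : 0 < ε)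
    (hge : ∀ x, ε ≤ g x) (hgM : ∀ x, g x ≤ M) (B : ℝ → ℝ) (hB : Integrable B (nuMeasure p))
    (hgB : ∀ x, |g' x| ^ q * g x ^ (1 - q) ≤ B x) :
    entropy (nuMeasure p) g ≤ 2 / q * ∫ x, B x ∂(nuMeasure p) := by
  have hq0 : 0 < q := (aux_conj p hp q hq).symm.pos
  have hpos : ∀ x, 0 < g x := fun x => hε.trans_le (hge x)
  have hwc := wgt_cont p hp
  have hwi := wgt_int p hp
  have hZ := wgtZ_pos p hp
  have hgc : Continuous g := continuous_iff_continuousAt.2 fun x => (hg x).continuousAt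
  have hgw : Integrable (fun x => g x * wgt p x) := by
    refine hwi.bdd_mul hgc.aestronglyMeasurable (c := M) (Filter.Eventually.of_forall fun x => ?_)
    rw [Real.norm_eq_abs, abs_of_pos (hpos x)]; exact hgM x
  have hlc : Continuous (fun x => g x * log (g x)) := hgc.mul (hgc.log (fun x => (hpos x).ne'))
  have hlw : Integrable (fun x => g x * log (g x) * wgt p x) := by
    obtain ⟨C, hC⟩ := (isCompact_Icc (a := ε) (b := M)).exists_bound_of_continuousOn
      (f := fun t => t * log t) Real.continuous_mul_log.continuousOn
    exact hwi.bdd_mul hlc.aestronglyMeasurable (c := C) (Filter.Eventually.of_forall fun x => hC _ ⟨hge x, hgM x⟩)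
  have hBw := (nu_integrable p hp B hB).const_mul (2 / q)
  have tl : ∀ h : ℝ → ℝ, Integrable h → Filter.Tendsto (fun R : ℝ => ∫ x in (-R)..R, h x) Filter.atTop (nhds (∫ x, h x)) :=
    fun h hh => intervalIntegral_tendsto_integral hh Filter.tendsto_neg_atTop_atBot Filter.tendsto_id
  have hIpos : 0 < ∫ x, g x * wgt p x := by
    have : ∫ x, ε * wgt p x ≤ ∫ x, g x * wgt p x :=
      integral_mono (hwi.const_mul ε) hgw (fun x => mul_le_mul_of_nonneg_right (hge x) (wgt_pos p x).le)
    rw [integral_const_mul] at this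
    exact (mul_pos hε hZ).trans_le this
  have key : (∫ x, g x * log (g x) * wgt p x) - (∫ x, g x * wgt p x) *
      log ((∫ x, g x * wgt p x) / wgtZ p) ≤ ∫ x, 2 / q * (B x * wgt p x) := by
    refine le_of_tendsto_of_tendsto ((tl _ hlw).sub ((tl _ hgw).mul
      (((tl _ hgw).div (tl _ hwi) hZ.ne').log (div_pos hIpos hZ).ne'))) (tl _ hBw) ?_
    filter_upwards [Filter.eventually_gt_atTop 0] with R hR
    refine (aux_interval' p hp q hq g g' hg hg' hpos R hR).trans ?_
    apply intervalIntegral.integral_mono_on (by linarith)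
    · have h1 : Continuous (fun x => |g' x| ^ q) := (continuous_abs.comp hg').rpow_const (fun _ => Or.inr hq0.le)
      have h2 : Continuous (fun x => g x ^ (1 - q)) := hgc.rpow_const (fun x => Or.inl (hpos x).ne')
      exact Continuous.intervalIntegrable (by fun_prop) _ _
    · exact hBw.intervalIntegrable
    · intro x _
      rw [mul_assoc]
      have := mul_le_mul_of_nonneg_right (hgB x) (wgt_pos p x).le
      gcongr
  unfold entropy
  simp_rw [nu_integral p hp]
  rw [integral_const_mul] at key
  rw [div_mul_eq_mul_div, ← sub_div, mul_div_assoc']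
  exact div_le_div_of_nonneg_right key hZ.le


theorem bdd_integrable {α : Type*} [MeasurableSpace α] (μ : Measure α) [IsProbabilityMeasure μ]
    (g : α → ℝ) (hg : Measurable g) (C : ℝ) (hC : ∀ x, |g x| ≤ C) : Integrable g μ :=
  Integrable.of_bound hg.aestronglyMeasurable C (Filter.Eventually.of_forall hC)

theorem bdd_int_mem {α : Type*} [MeasurableSpace α] (μ : Measure α) [IsProbabilityMeasure μ]
    (g : α → ℝ) (hg : Integrable g μ) (ε M : ℝ) (h : ∀ x, g x ∈ Set.Icc ε M) :
    ∫ x, g x ∂μ ∈ Set.Icc ε M := by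
  constructor
  · have := integral_mono (integrable_const ε) hg (fun x => (h x).1)
    simpa using this
  · have := integral_mono hg (integrable_const M) (fun x => (h x).2)
    simpa using this

theorem bdd_log (ε M : ℝ) (hε : 0 < ε) : ∃ C : ℝ, 0 ≤ C ∧ ∀ a ∈ Set.Icc ε M, ∀ b ∈ Set.Icc ε M, |a * log b| ≤ C := by
  obtain ⟨C, hC⟩ := (isCompact_Icc (a := ε) (b := M)).exists_bound_of_continuousOn
      (f := fun t => log t) (Real.continuousOn_log.mono (fun x hx => by
        simp only [Set.mem_compl_iff, Set.mem_singleton_iff]; exact (hε.trans_le hx.1).ne'))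
  refine ⟨|M| * |C|, by positivity, fun a ha b hb => ?_⟩
  rw [abs_mul]
  apply mul_le_mul _ _ (abs_nonneg _) (abs_nonneg _)
  · rw [abs_of_pos (hε.trans_le ha.1)]; exact ha.2.trans (le_abs_self _)
  · exact (hC b hb).trans (le_abs_self _)

theorem gibbs {α : Type*} [MeasurableSpace α] (μ : Measure α) [IsProbabilityMeasure μ]
    (g h : α → ℝ) (hg : Measurable g) (hh : Measurable h) (ε M : ℝ) (hε : 0 < ε)
    (hgb : ∀ x, g x ∈ Set.Icc ε M) (hhb : ∀ x, h x ∈ Set.Icc ε M) :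
    (∫ x, g x * log (h x) ∂μ) - (∫ x, g x ∂μ) * log (∫ x, h x ∂μ) ≤ entropy μ g := by
  obtain ⟨C, hC0, hC⟩ := bdd_log ε M hε
  have hgp : ∀ x, 0 < g x := fun x => hε.trans_le (hgb x).1
  have hhp : ∀ x, 0 < h x := fun x => hε.trans_le (hhb x).1
  have habs : ∀ t ∈ Set.Icc ε M, |t| ≤ M := fun t ht => by
    rw [abs_of_pos (hε.trans_le ht.1)]; exact ht.2
  have ig := bdd_integrable μ g hg M (fun x => habs _ (hgb x))
  have ih := bdd_integrable μ h hh M (fun x => habs _ (hhb x))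
  have igh := bdd_integrable μ (fun x => g x * log (h x)) (hg.mul hh.log) C (fun x => hC _ (hgb x) _ (hhb x))
  have igg := bdd_integrable μ (fun x => g x * log (g x)) (hg.mul hg.log) C (fun x => hC _ (hgb x) _ (hgb x))
  have hA := hε.trans_le (bdd_int_mem μ g ig ε M hgb).1
  have hB := hε.trans_le (bdd_int_mem μ h ih ε M hhb).1
  unfold entropy
  set A := ∫ x, g x ∂μ with hAd
  set B := ∫ x, h x ∂μ with hBd
  have hpt : ∀ x, g x * log (h x) - g x * log (g x) ≤ (A / B) * h x - g x + (log B - log A) * g x := by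
    intro x
    have h1 := Real.log_le_sub_one_of_pos (x := (h x / B) / (g x / A)) (by
      have := hgp x; have := hhp x; positivity)
    rw [Real.log_div (div_pos (hhp x) hB).ne' (div_pos (hgp x) hA).ne', Real.log_div (hhp x).ne' hB.ne',
      Real.log_div (hgp x).ne' hA.ne'] at h1
    have h2 := mul_le_mul_of_nonneg_left h1 (hgp x).le
    have h3 : g x * ((h x / B) / (g x / A) - 1) = (A / B) * h x - g x := by
      have := (hgp x).ne'
      field_simp
    rw [h3] at h2
    linarith
  have := integral_mono (igh.sub igg) (((ih.const_mul (A / B)).sub ig).add (ig.const_mul (log B - log A))) hpt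
  have e1 : ∫ x, (fun x => g x * log (h x)) x - (fun x => g x * log (g x)) x ∂μ = _ := integral_sub igh igg
  have e2 : ∫ x, (A / B) * h x - g x + (log B - log A) * g x ∂μ = A / B * B - A + (log B - log A) * A := by
    have i1 : Integrable (fun x => (A / B) * h x - g x) μ := (ih.const_mul (A / B)).sub ig
    rw [integral_add i1 (ig.const_mul (log B - log A)),
      integral_sub (ih.const_mul (A / B)) ig, integral_const_mul, integral_const_mul]
  have e3 : A / B * B = A := by field_simp
  have : (∫ x, g x * log (h x) ∂μ) - ∫ x, g x * log (g x) ∂μ ≤ A / B * B - A + (log B - log A) * A := by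
    rw [← e1, ← e2]; exact this
  rw [e3] at this
  linarith

theorem ent_nonneg {α : Type*} [MeasurableSpace α] (μ : Measure α) [IsProbabilityMeasure μ]
    (g : α → ℝ) (hg : Measurable g) (ε M : ℝ) (hε : 0 < ε)
    (hgb : ∀ x, g x ∈ Set.Icc ε M) : 0 ≤ entropy μ g := by
  have hne : Nonempty α := by
    by_contra h
    rw [not_nonempty_iff] at h
    exact IsProbabilityMeasure.ne_zero μ (Measure.eq_zero_of_isEmpty μ)
  obtain ⟨x0⟩ := hne
  have := gibbs μ g (fun _ => ε) hg measurable_const ε M hε hgb (fun x => ⟨le_rfl, (hgb x0).1.trans (hgb x0).2⟩)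
  simpa [integral_mul_const] using this

theorem ent_measurable {α β : Type*} [MeasurableSpace α] [MeasurableSpace β] (μ : Measure α) [IsProbabilityMeasure μ]
    (G : α → β → ℝ) (hG : Measurable (Function.uncurry G)) :
    Measurable (fun y => entropy μ (fun x => G x y)) := by
  have h1 : ∀ F : α → β → ℝ, Measurable (Function.uncurry F) → Measurable (fun y => ∫ x, F x y ∂μ) := by
    intro F hF
    have : Measurable (Function.uncurry (fun y x => F x y)) := hF.comp measurable_swap
    exact this.stronglyMeasurable.integral_prod_right.measurable
  unfold entropy
  exact (h1 (fun x y => G x y * log (G x y)) (hG.mul hG.log)).sub ((h1 G hG).mul (h1 G hG).log)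

theorem ent_bdd (ε M : ℝ) (hε : 0 < ε) : ∃ C : ℝ, ∀ {α : Type} [MeasurableSpace α] (μ : Measure α) [IsProbabilityMeasure μ]
    (g : α → ℝ) (hg : Measurable g)
    (hgb : ∀ x, g x ∈ Set.Icc ε M), |entropy μ g| ≤ C := by
  obtain ⟨C, hC0, hC⟩ := bdd_log ε M hε
  refine ⟨2 * C, fun μ _ g hg hgb => ?_⟩
  have habs : ∀ t ∈ Set.Icc ε M, |t| ≤ M := fun t ht => by
    rw [abs_of_pos (hε.trans_le ht.1)]; exact ht.2
  have ig := bdd_integrable μ g hg M (fun x => habs _ (hgb x))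
  have hA := bdd_int_mem μ g ig ε M hgb
  have h1 := hC _ hA _ hA
  have h2 : |∫ x, g x * log (g x) ∂μ| ≤ C := by
    have := norm_integral_le_of_norm_le_const (μ := μ) (f := fun x => g x * log (g x)) (C := C)
      (Filter.Eventually.of_forall fun x => hC _ (hgb x) _ (hgb x))
    simpa using this
  unfold entropy
  have h3 := abs_sub (∫ x, g x * log (g x) ∂μ) ((∫ x, g x ∂μ) * log (∫ x, g x ∂μ))
  linarith

theorem ent_prod {α β : Type} [MeasurableSpace α] [MeasurableSpace β] (μ : Measure α) [IsProbabilityMeasure μ]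
    (ν : Measure β) [IsProbabilityMeasure ν]
    (G : α → β → ℝ) (hG : Measurable (Function.uncurry G)) (ε M : ℝ) (hε : 0 < ε)
    (hGb : ∀ x y, G x y ∈ Set.Icc ε M) :
    entropy (μ.prod ν) (Function.uncurry G) ≤
      (∫ x, entropy ν (fun y => G x y) ∂μ) + ∫ y, entropy μ (fun x => G x y) ∂ν := by
  obtain ⟨C, hC0, hC⟩ := bdd_log ε M hε
  obtain ⟨D, hD⟩ := ent_bdd ε M hε
  have habs : ∀ t ∈ Set.Icc ε M, |t| ≤ M := fun t ht => by
    rw [abs_of_pos (hε.trans_le ht.1)]; exact ht.2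
  have mx : ∀ x, Measurable (fun y => G x y) := fun x => hG.comp measurable_prodMk_left
  have my : ∀ y, Measurable (fun x => G x y) := fun y => hG.comp measurable_prodMk_right
  have hGs : Measurable (Function.uncurry (fun y x => G x y)) := hG.comp measurable_swap
  let H : β → ℝ := fun y => ∫ x, G x y ∂μ
  have hHm : Measurable H := hGs.stronglyMeasurable.integral_prod_right.measurable
  have hHb : ∀ y, H y ∈ Set.Icc ε M := fun y =>
    bdd_int_mem μ _ (bdd_integrable μ _ (my y) M (fun x => habs _ (hGb x y))) ε M (fun x => hGb x y)
  have iG := bdd_integrable (μ.prod ν) (Function.uncurry G) hG M (fun z => habs _ (hGb z.1 z.2))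
  have iGH := bdd_integrable (μ.prod ν) (fun z => G z.1 z.2 * log (H z.2)) (hG.mul (hHm.comp measurable_snd).log) C
    (fun z => hC _ (hGb z.1 z.2) _ (hHb z.2))
  have iGG := bdd_integrable (μ.prod ν) (fun z => G z.1 z.2 * log (G z.1 z.2)) (hG.mul hG.log) C
    (fun z => hC _ (hGb z.1 z.2) _ (hGb z.1 z.2))
  have iH := bdd_integrable ν H hHm M (fun y => habs _ (hHb y))
  have iHH := bdd_integrable ν (fun y => H y * log (H y)) (hHm.mul hHm.log) C (fun y => hC _ (hHb y) _ (hHb y))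
  -- Gibbs
  have g1 : ∀ x, (∫ y, G x y * log (H y) ∂ν) - (∫ y, G x y ∂ν) * log (∫ y, H y ∂ν) ≤ entropy ν (fun y => G x y) :=
    fun x => gibbs ν (fun y => G x y) H (mx x) hHm ε M hε (hGb x) hHb
  have iE1 : Integrable (fun x => entropy ν (fun y => G x y)) μ :=
    bdd_integrable μ _ (ent_measurable ν (fun y x => G x y) hGs) D (fun x => hD ν _ (mx x) (hGb x))
  have g2 := integral_mono (iGH.integral_prod_left.sub (iG.integral_prod_left.mul_const (log (∫ y, H y ∂ν)))) iE1 g1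
  have e1 : ∫ x, (∫ y, G x y * log (H y) ∂ν) - (∫ y, G x y ∂ν) * log (∫ y, H y ∂ν) ∂μ =
      (∫ y, H y * log (H y) ∂ν) - (∫ y, H y ∂ν) * log (∫ y, H y ∂ν) := by
    have i1 : Integrable (fun x => ∫ y, G x y * log (H y) ∂ν) μ := iGH.integral_prod_left
    have i2 : Integrable (fun x => ∫ y, G x y ∂ν) μ := iG.integral_prod_left
    rw [integral_sub i1 (i2.mul_const (log (∫ y, H y ∂ν))), integral_mul_const,
      integral_integral_swap iGH, integral_integral_swap iG]
    simp_rw [integral_mul_const]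
    rfl
  have e2 : ∫ y, entropy μ (fun x => G x y) ∂ν =
      (∫ z, G z.1 z.2 * log (G z.1 z.2) ∂(μ.prod ν)) - ∫ y, H y * log (H y) ∂ν := by
    unfold entropy
    rw [integral_sub iGG.integral_prod_right iHH, integral_prod_symm _ iGG]
  have e3 : ∫ z, Function.uncurry G z ∂(μ.prod ν) = ∫ y, H y ∂ν := integral_prod_symm _ iG
  rw [e2]
  have g3 : (∫ y, H y * log (H y) ∂ν) - (∫ y, H y ∂ν) * log (∫ y, H y ∂ν) ≤ ∫ x, entropy ν (fun y => G x y) ∂μ := by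
    rw [← e1]; exact g2
  have e4 : entropy (μ.prod ν) (Function.uncurry G) = (∫ z, G z.1 z.2 * log (G z.1 z.2) ∂(μ.prod ν)) -
      (∫ y, H y ∂ν) * log (∫ y, H y ∂ν) := by
    rw [← e3]; rfl
  rw [e4]
  linarith


theorem lint_resample (ν : Measure ℝ) [IsProbabilityMeasure ν] (n : ℕ) (i : Fin n) (D : (Fin n → ℝ) → ENNReal)
    (hD : Measurable D) :
    ∫⁻ x, ∫⁻ s, D (Function.update x i s) ∂ν ∂(Measure.pi fun _ : Fin n => ν) = ∫⁻ x, D x ∂(Measure.pi fun _ => ν) := by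
  cases n with
  | zero => exact i.elim0
  | succ n =>
    have mp := (measurePreserving_piFinSuccAbove (fun _ : Fin (n + 1) => ν) i).symm
    have hm : Measurable (fun x : Fin (n + 1) → ℝ => ∫⁻ s, D (Function.update x i s) ∂ν) := by
      apply Measurable.lintegral_prod_right'  (f := fun z : (Fin (n + 1) → ℝ) × ℝ => D (Function.update z.1 i z.2))
      apply hD.comp
      rw [measurable_pi_iff]
      intro j
      by_cases h : j = i
      · subst h; simpa using measurable_snd
      · simp only [Function.update_of_ne h]; exact (measurable_pi_apply j).comp measurable_fst
    have e : ∀ z : ℝ × (Fin n → ℝ), (MeasurableEquiv.piFinSuccAbove (fun _ : Fin (n + 1) => ℝ) i).symm z = i.insertNth z.1 z.2 := fun z => rfl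
    rw [← mp.lintegral_comp hm, ← mp.lintegral_comp hD]
    simp_rw [e, Fin.update_insertNth]
    have hD' : Measurable (fun z : ℝ × (Fin n → ℝ) => D (i.insertNth z.1 z.2)) := hD.comp mp.measurable
    rw [lintegral_prod_symm _ hD'.aemeasurable]
    rw [lintegral_prod_symm _ (by
      have h3 : Measurable (fun y : Fin n → ℝ => ∫⁻ s, D (i.insertNth s y) ∂ν) := hD'.lintegral_prod_left'
      exact (h3.comp measurable_snd).aemeasurable)]
    simp

theorem ent_tensor (ν : Measure ℝ) [IsProbabilityMeasure ν] (n : ℕ) (G : (Fin n → ℝ) → ℝ) (hG : Measurable G)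
    (ε M : ℝ) (hε : 0 < ε) (hGb : ∀ x, G x ∈ Set.Icc ε M) :
    ENNReal.ofReal (entropy (Measure.pi fun _ : Fin n => ν) G) ≤
      ∑ i, ∫⁻ x, ENNReal.ofReal (entropy ν (fun s => G (Function.update x i s))) ∂(Measure.pi fun _ : Fin n => ν) := by
  induction n with
  | zero =>
    have : entropy (Measure.pi fun _ : Fin 0 => ν) G = 0 := by
      unfold entropy
      rw [Measure.pi_of_empty (fun _ : Fin 0 => ν) 0]
      simp
    simp [this]
  | succ n ih =>
    set ρ := Measure.pi fun _ : Fin n => ν with hρ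
    have mp : MeasurePreserving (MeasurableEquiv.piFinSuccAbove (fun _ : Fin (n + 1) => ℝ) 0).symm
      (ν.prod ρ) (Measure.pi fun _ : Fin (n + 1) => ν) := (measurePreserving_piFinSuccAbove (fun _ : Fin (n + 1) => ν) 0).symm
    have e : ∀ z : ℝ × (Fin n → ℝ), (MeasurableEquiv.piFinSuccAbove (fun _ : Fin (n + 1) => ℝ) 0).symm z = Fin.cons z.1 z.2 := fun z => by
      rw [← Fin.insertNth_zero']; rfl
    let G' : ℝ → (Fin n → ℝ) → ℝ := fun t y => G (Fin.cons t y)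
    have hG' : Measurable (Function.uncurry G') := by
      have := hG.comp mp.measurable
      convert this using 1
      ext z
      simp only [Function.comp, e]; rfl
    have hG's : Measurable (Function.uncurry (fun y t => G' t y)) := hG'.comp measurable_swap
    obtain ⟨D, hD⟩ := ent_bdd ε M hε
    have e1 : entropy (Measure.pi fun _ : Fin (n + 1) => ν) G = entropy (ν.prod ρ) (Function.uncurry G') := by
      unfold entropy
      rw [← mp.integral_comp' , ← mp.integral_comp']
      simp only [e]; rfl
    have mx : ∀ t, Measurable (G' t) := fun t => hG'.comp measurable_prodMk_left
    have my : ∀ y, Measurable (fun t => G' t y) := fun y => hG'.comp measurable_prodMk_right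
    have m1 : Measurable (fun t => entropy ρ (G' t)) := ent_measurable ρ (fun y t => G' t y) hG's
    have m2 : Measurable (fun y => entropy ν (fun t => G' t y)) := ent_measurable ν G' hG'
    have p1 : ∀ t, 0 ≤ entropy ρ (G' t) := fun t => ent_nonneg ρ _ (mx t) ε M hε (fun y => hGb _)
    have p2 : ∀ y, 0 ≤ entropy ν (fun t => G' t y) := fun y => ent_nonneg ν _ (my y) ε M hε (fun t => hGb _)
    have i1 : Integrable (fun t => entropy ρ (G' t)) ν := bdd_integrable ν _ m1 D (fun t => hD ρ _ (mx t) (fun y => hGb _))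
    have i2 : Integrable (fun y => entropy ν (fun t => G' t y)) ρ := bdd_integrable ρ _ m2 D (fun y => hD ν _ (my y) (fun t => hGb _))
    have hmu : ∀ (j : Fin (n + 1)), Measurable (fun x : Fin (n + 1) → ℝ => ENNReal.ofReal (entropy ν (fun s => G (Function.update x j s)))) := by
      intro j
      apply Measurable.ennreal_ofReal
      apply ent_measurable ν (fun s (x : Fin (n + 1) → ℝ) => G (Function.update x j s))
      apply hG.comp
      rw [measurable_pi_iff]
      intro k
      by_cases h : k = j
      · subst h; simpa using measurable_fst
      · simp only [Function.update_of_ne h]; exact (measurable_pi_apply k).comp measurable_snd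
    have hm' : ∀ (j : Fin (n + 1)), Measurable (fun z : ℝ × (Fin n → ℝ) => ENNReal.ofReal (entropy ν (fun s => G (Function.update (Fin.cons z.1 z.2 : Fin (n + 1) → ℝ) j s)))) := by
      intro j
      have := (hmu j).comp mp.measurable
      simpa only [Function.comp_def, e] using this
    rw [e1]
    refine (ENNReal.ofReal_le_ofReal (ent_prod ν ρ G' hG' ε M hε (fun x y => hGb _))).trans ?_
    rw [ENNReal.ofReal_add (integral_nonneg p1) (integral_nonneg p2),
      ofReal_integral_eq_lintegral_ofReal i1 (Filter.Eventually.of_forall p1),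
      ofReal_integral_eq_lintegral_ofReal i2 (Filter.Eventually.of_forall p2), Fin.sum_univ_succ, add_comm]
    apply add_le_add
    · rw [← mp.lintegral_comp (hmu 0)]
      simp only [e, Fin.update_cons_zero]
      have h3 : Measurable (fun z : ℝ × (Fin n → ℝ) => ENNReal.ofReal (entropy ν (fun s => G (Fin.cons s z.2)))) :=
        (m2.comp measurable_snd).ennreal_ofReal
      rw [lintegral_prod _ h3.aemeasurable]
      simp [G']
    · calc _ ≤ ∫⁻ t, ∑ i, ∫⁻ y, ENNReal.ofReal (entropy ν (fun s => G' t (Function.update y i s))) ∂ρ ∂ν :=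
            lintegral_mono (fun t => ih (G' t) (mx t) (fun y => hGb _))
        _ = ∑ i : Fin n, ∫⁻ t, ∫⁻ y, ENNReal.ofReal (entropy ν (fun s => G' t (Function.update y i s))) ∂ρ ∂ν := by
            rw [lintegral_finset_sum]
            intro i _
            have := (hm' i.succ).lintegral_prod_right' (ν := ρ)
            simpa only [← Fin.cons_update] using this
        _ ≤ _ := by
            apply Finset.sum_le_sum
            intro i _
            rw [← mp.lintegral_comp (hmu i.succ)]
            simp only [e]
            rw [lintegral_prod _ (hm' i.succ).aemeasurable]
            simp only [← Fin.cons_update]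
            exact le_rfl


open scoped Pointwise

theorem lpNorm_nonneg (p : ℝ) {n : ℕ} (x : Fin n → ℝ) : 0 ≤ lpNorm p x := by
  unfold _root_.lpNorm; positivity

theorem lpNorm_pow (p : ℝ) (hp : 2 ≤ p) {n : ℕ} (x : Fin n → ℝ) : lpNorm p x ^ p = ∑ i, |x i| ^ p := by
  unfold _root_.lpNorm
  rw [← Real.rpow_mul (by positivity), one_div_mul_cancel (by linarith), Real.rpow_one]

theorem lpNorm_cont (p : ℝ) (hp : 2 ≤ p) (n : ℕ) : Continuous (lpNorm p : (Fin n → ℝ) → ℝ) := by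
  unfold _root_.lpNorm
  refine Continuous.rpow_const (continuous_finset_sum _ fun i _ => ?_) (fun _ => Or.inr (by positivity))
  exact (continuous_abs.comp (continuous_apply i)).rpow_const (fun _ => Or.inr (by linarith))

theorem lpNorm_smul (p : ℝ) (hp : 2 ≤ p) {n : ℕ} (c : ℝ) (x : Fin n → ℝ) : lpNorm p (c • x) = |c| * lpNorm p x := by
  unfold _root_.lpNorm
  have : ∀ i, |(c • x) i| ^ p = |c| ^ p * |x i| ^ p := by
    intro i
    rw [Pi.smul_apply, smul_eq_mul, abs_mul, Real.mul_rpow (abs_nonneg _) (abs_nonneg _)]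
  simp_rw [this]
  rw [← Finset.mul_sum, Real.mul_rpow (by positivity) (by positivity), ← Real.rpow_mul (abs_nonneg _),
    mul_one_div_cancel (by linarith), Real.rpow_one]

theorem lpNorm_pos (p : ℝ) {n : ℕ} (x : Fin n → ℝ) (j : Fin n) (hj : x j ≠ 0) : 0 < lpNorm p x := by
  unfold _root_.lpNorm
  apply Real.rpow_pos_of_pos
  apply Finset.sum_pos' (fun i _ => by positivity) ⟨j, Finset.mem_univ _, ?_⟩
  have : 0 < |x j| := abs_pos.2 hj
  positivity

theorem theta_meas (p : ℝ) (hp : 2 ≤ p) (n : ℕ) : Measurable (fun x : Fin n → ℝ => (lpNorm p x)⁻¹ • x) :=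
  (lpNorm_cont p hp n).measurable.inv.smul measurable_id

theorem ball_vol (p : ℝ) (hp : 2 ≤ p) (n : ℕ) (hn : 0 < n) :
    volume {x : Fin n → ℝ | lpNorm p x ≤ 1} ≠ 0 ∧ volume {x : Fin n → ℝ | lpNorm p x ≤ 1} ≠ ⊤ := by
  have : Nonempty (Fin n) := ⟨⟨0, hn⟩⟩
  have h := volume_sum_rpow_le (ι := Fin n) (p := p) (by linarith) 1
  have h' : volume {x : Fin n → ℝ | lpNorm p x ≤ 1} = _ := h
  rw [h']
  have h1 : 0 < Real.Gamma (1 / p + 1) := Real.Gamma_pos_of_pos (by positivity)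
  have h2 : 0 < Real.Gamma ((Fintype.card (Fin n) : ℝ) / p + 1) := Real.Gamma_pos_of_pos (by positivity)
  constructor
  · simp only [ENNReal.ofReal_one, one_pow, one_mul, ne_eq, ENNReal.ofReal_eq_zero, not_le]
    positivity
  · simp

theorem ball_vol_nonpos (p : ℝ) (hp : 2 ≤ p) (n : ℕ) (hn : 0 < n) (r : ℝ) (hr : r ≤ 0) :
    volume {x : Fin n → ℝ | lpNorm p x ≤ r} = 0 := by
  have : Nonempty (Fin n) := ⟨⟨0, hn⟩⟩
  have h := volume_sum_rpow_le (ι := Fin n) (p := p) (by linarith) r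
  have h' : volume {x : Fin n → ℝ | lpNorm p x ≤ r} = _ := h
  rw [h', ENNReal.ofReal_of_nonpos hr]
  simp [hn.ne']

/-- radial measure -/
noncomputable def kap (n : ℕ) : Measure ℝ :=
  (volume.restrict (Set.Ioi 0)).withDensity (fun r => ENNReal.ofReal (n * r ^ (n - 1)))

theorem kap_Iic (n : ℕ) (hn : 0 < n) (r : ℝ) : kap n (Set.Iic r) = ENNReal.ofReal r ^ n := by
  unfold kap
  rw [withDensity_apply _ measurableSet_Iic, Measure.restrict_restrict measurableSet_Iic]
  rcases le_or_gt r 0 with h | h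
  · have : Set.Iic r ∩ Set.Ioi 0 = ∅ := by
      ext t; simp only [Set.mem_inter_iff, Set.mem_Iic, Set.mem_Ioi, Set.mem_empty_iff_false, iff_false]
      intro ht; linarith
    rw [this, ENNReal.ofReal_of_nonpos h]
    simp [hn.ne']
  · have : Set.Iic r ∩ Set.Ioi 0 = Set.Ioc 0 r := by
      rw [Set.inter_comm]; rfl
    rw [this]
    have hc : Continuous (fun r : ℝ => (n : ℝ) * r ^ (n - 1)) := by fun_prop
    rw [← ofReal_integral_eq_lintegral_ofReal]
    · rw [← intervalIntegral.integral_of_le h.le, intervalIntegral.integral_const_mul, integral_pow,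
        ← ENNReal.ofReal_pow h.le]
      congr 1
      obtain ⟨m, rfl⟩ : ∃ m, n = m + 1 := ⟨n - 1, by omega⟩
      have : (m : ℝ) + 1 ≠ 0 := by positivity
      simp
      field_simp
    · exact (hc.integrableOn_Icc).mono_set Set.Ioc_subset_Icc_self
    · filter_upwards [ae_restrict_mem measurableSet_Ioc] with t ht
      have := ht.1
      simp only [Pi.zero_apply]
      positivity

theorem cone_apply (p : ℝ) (hp : 2 ≤ p) (n : ℕ) (hn : 0 < n) (A : Set (Fin n → ℝ)) (hA : MeasurableSet A) :
    coneMeasure p n A * volume {x : Fin n → ℝ | lpNorm p x ≤ 1} =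
      volume ((fun x : Fin n → ℝ => (lpNorm p x)⁻¹ • x) ⁻¹' A ∩ {x : Fin n → ℝ | lpNorm p x ≤ 1}) := by
  have hb := ball_vol p hp n hn
  unfold coneMeasure
  rw [Measure.map_apply (theta_meas p hp n) hA, Measure.smul_apply,
    Measure.restrict_apply ((theta_meas p hp n) hA), smul_eq_mul, mul_comm, ← mul_assoc,
    ENNReal.mul_inv_cancel hb.1 hb.2, one_mul]

theorem cone_prob (p : ℝ) (hp : 2 ≤ p) (n : ℕ) (hn : 0 < n) : IsProbabilityMeasure (coneMeasure p n) := by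
  have hb := ball_vol p hp n hn
  constructor
  have := cone_apply p hp n hn Set.univ MeasurableSet.univ
  rw [Set.preimage_univ, Set.univ_inter] at this
  exact (ENNReal.mul_eq_right hb.1 hb.2).1 this

theorem cone_radial (p : ℝ) (hp : 2 ≤ p) (n : ℕ) (hn : 0 < n) (A : Set (Fin n → ℝ)) (hA : MeasurableSet A) (r : ℝ) :
    volume ((fun x : Fin n → ℝ => (lpNorm p x)⁻¹ • x) ⁻¹' A ∩ {x : Fin n → ℝ | lpNorm p x ≤ r}) =
     (coneMeasure p n A * volume {x : Fin n → ℝ | lpNorm p x ≤ 1}) * ENNReal.ofReal r ^ n := by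
  rw [cone_apply p hp n hn A hA]
  rcases le_or_gt r 0 with h | h
  · rw [ENNReal.ofReal_of_nonpos h, zero_pow hn.ne', mul_zero]
    exact measure_mono_null Set.inter_subset_right (ball_vol_nonpos p hp n hn r h)
  · have : (fun x : Fin n → ℝ => (lpNorm p x)⁻¹ • x) ⁻¹' A ∩ {x : Fin n → ℝ | lpNorm p x ≤ r} =
      r • ((fun x : Fin n → ℝ => (lpNorm p x)⁻¹ • x) ⁻¹' A ∩ {x : Fin n → ℝ | lpNorm p x ≤ 1}) := by
      ext x
      rw [Set.mem_smul_set_iff_inv_smul_mem₀ h.ne']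
      simp only [Set.mem_inter_iff, Set.mem_preimage, Set.mem_setOf_eq, lpNorm_smul p hp, abs_inv, abs_of_pos h]
      have e1 : (r⁻¹ * lpNorm p x)⁻¹ • r⁻¹ • x = (lpNorm p x)⁻¹ • x := by
        rw [smul_smul]; congr 1; rw [mul_inv, inv_inv]; field_simp
      rw [e1, inv_mul_le_iff₀ h, mul_one]
    rw [this, Measure.addHaar_smul, Module.finrank_fin_fun, abs_of_pos (by positivity), ENNReal.ofReal_pow h.le, mul_comm]

theorem polar_prod (p : ℝ) (hp : 2 ≤ p) (n : ℕ) (hn : 0 < n) :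
    Measure.map (fun x : Fin n → ℝ => ((lpNorm p x)⁻¹ • x, lpNorm p x)) volume =
      (coneMeasure p n).prod (volume {x : Fin n → ℝ | lpNorm p x ≤ 1} • kap n) := by
  have hb := ball_vol p hp n hn
  have := cone_prob p hp n hn
  have hNm := (lpNorm_cont p hp n).measurable
  have hk : SigmaFinite (kap n) := by unfold kap; infer_instance
  have hk2 : SFinite (kap n) := inferInstance
  have hvk : SigmaFinite (volume {x : Fin n → ℝ | lpNorm p x ≤ 1} • kap n) := by
    have e : volume {x : Fin n → ℝ | lpNorm p x ≤ 1} • kap n =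
        (volume {x : Fin n → ℝ | lpNorm p x ≤ 1}).toNNReal • kap n := by
      conv_lhs => rw [← ENNReal.coe_toNNReal hb.2]
      rfl
    rw [e]
    infer_instance
  symm
  apply Measure.prod_eq
  intro A t hA ht
  rw [Measure.map_apply ((theta_meas p hp n).prodMk hNm) (hA.prod ht)]
  have key : Measure.map (lpNorm p) (volume.restrict ((fun x : Fin n → ℝ => (lpNorm p x)⁻¹ • x) ⁻¹' A)) =
      (coneMeasure p n A * volume {x : Fin n → ℝ | lpNorm p x ≤ 1}) • kap n := by
    have val : ∀ r, Measure.map (lpNorm p) (volume.restrict ((fun x : Fin n → ℝ => (lpNorm p x)⁻¹ • x) ⁻¹' A)) (Set.Iic r) =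
        (coneMeasure p n A * volume {x : Fin n → ℝ | lpNorm p x ≤ 1}) * ENNReal.ofReal r ^ n := by
      intro r
      rw [Measure.map_apply hNm measurableSet_Iic, Measure.restrict_apply (hNm measurableSet_Iic), Set.inter_comm,
        ← cone_radial p hp n hn A hA r]
      rfl
    apply Measure.ext_of_generateFrom_of_iUnion (Set.range Set.Iic) (fun k : ℕ => Set.Iic (k : ℝ))
      (by rw [← borel_eq_generateFrom_Iic]; exact BorelSpace.measurable_eq) isPiSystem_Iic
    · ext x
      simp only [Set.mem_iUnion, Set.mem_Iic, Set.mem_univ, iff_true]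
      exact exists_nat_ge x
    · intro k; exact ⟨_, rfl⟩
    · intro k
      rw [val]
      exact ENNReal.mul_ne_top (ENNReal.mul_ne_top (measure_ne_top _ _) hb.2) (by simp)
    · rintro _ ⟨r, rfl⟩
      rw [val, Measure.smul_apply, kap_Iic n hn, smul_eq_mul]
  have := congrArg (fun m => m t) key
  rw [Measure.map_apply hNm ht, Measure.restrict_apply (hNm ht), Set.inter_comm] at this
  rw [Measure.smul_apply, smul_eq_mul, ← mul_assoc]
  exact this

theorem polar_lint (p : ℝ) (hp : 2 ≤ p) (n : ℕ) (hn : 0 < n) (h : (Fin n → ℝ) → ENNReal) (hh : Measurable h)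
    (r : ℝ → ENNReal) (hr : Measurable r) :
    ∫⁻ x : Fin n → ℝ, h ((lpNorm p x)⁻¹ • x) * r (lpNorm p x) =
      (∫⁻ x, h x ∂(coneMeasure p n)) * (volume {x : Fin n → ℝ | lpNorm p x ≤ 1} * ∫⁻ t, r t ∂(kap n)) := by
  have hNm := (lpNorm_cont p hp n).measurable
  have := cone_prob p hp n hn
  have hk : SigmaFinite (kap n) := by unfold kap; infer_instance
  have hk2 : SFinite (kap n) := inferInstance
  have e := lintegral_map (μ := volume) (f := fun z : (Fin n → ℝ) × ℝ => h z.1 * r z.2)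
    ((hh.comp measurable_fst).mul (hr.comp measurable_snd)) ((theta_meas p hp n).prodMk hNm)
  rw [← e, polar_prod p hp n hn, lintegral_prod_mul hh.aemeasurable hr.aemeasurable, lintegral_smul_measure, smul_eq_mul]

theorem pi_density (p : ℝ) (hp : 2 ≤ p) (n : ℕ) :
    Measure.pi (fun _ : Fin n => nuMeasure p) =
      volume.withDensity (fun x : Fin n → ℝ => ENNReal.ofReal (exp (-(lpNorm p x ^ p / p)) / wgtZ p ^ n)) := by
  have := nu_prob p hp
  have hZ := wgtZ_pos p hp
  have hden : ∀ x : Fin n → ℝ, exp (-(lpNorm p x ^ p / p)) / wgtZ p ^ n = ∏ i, (wgt p (x i) / wgtZ p) := by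
    intro x
    rw [Finset.prod_div_distrib, lpNorm_pow p hp, Finset.prod_const, Finset.card_univ, Fintype.card_fin]
    unfold wgt
    rw [← Real.exp_sum, Finset.sum_neg_distrib, Finset.sum_div]
  simp_rw [hden]
  apply Measure.pi_eq
  intro s hs
  rw [withDensity_apply _ (MeasurableSet.univ_pi hs), ← lintegral_indicator (MeasurableSet.univ_pi hs)]
  have hi : ∀ i, Integrable ((s i).indicator (fun t => wgt p t / wgtZ p)) := fun i =>
    ((wgt_int p hp).div_const _).indicator (hs i)
  have hnn : ∀ i t, 0 ≤ (s i).indicator (fun t => wgt p t / wgtZ p) t := fun i t =>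
    Set.indicator_nonneg (fun t _ => div_nonneg (wgt_pos p t).le hZ.le) t
  have e1 : ∀ x : Fin n → ℝ, (Set.univ.pi s).indicator (fun x : Fin n → ℝ => ENNReal.ofReal (∏ i, (wgt p (x i) / wgtZ p))) x =
      ENNReal.ofReal (∏ i, (s i).indicator (fun t => wgt p t / wgtZ p) (x i)) := by
    intro x
    by_cases hx : x ∈ Set.univ.pi s
    · rw [Set.indicator_of_mem hx]
      congr 1
      apply Finset.prod_congr rfl
      intro i _
      rw [Set.indicator_of_mem (hx i trivial)]
    · rw [Set.indicator_of_notMem hx]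
      simp only [Set.mem_pi, Set.mem_univ, true_implies, not_forall] at hx
      obtain ⟨i, hi⟩ := hx
      rw [Finset.prod_eq_zero (Finset.mem_univ i) (Set.indicator_of_notMem hi _)]
      simp
  simp_rw [e1]
  have hprod : Integrable (fun x : Fin n → ℝ => ∏ i, (s i).indicator (fun t => wgt p t / wgtZ p) (x i)) volume :=
    Integrable.fintype_prod hi
  rw [← ofReal_integral_eq_lintegral_ofReal hprod
    (Filter.Eventually.of_forall fun x => Finset.prod_nonneg fun i _ => hnn i _)]
  rw [integral_fintype_prod_volume_eq_prod (fun i => (s i).indicator (fun t => wgt p t / wgtZ p)),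
    ENNReal.ofReal_prod_of_nonneg (fun i _ => integral_nonneg (hnn i))]
  apply Finset.prod_congr rfl
  intro i _
  unfold nuMeasure
  rw [withDensity_apply _ (hs i), integral_indicator (hs i), ofReal_integral_eq_lintegral_ofReal
    ((wgt_int p hp).div_const _).integrableOn (Filter.Eventually.of_forall fun t => div_nonneg (wgt_pos p t).le hZ.le)]

theorem radial_val (p : ℝ) (hp : 2 ≤ p) (n : ℕ) (hn : 0 < n) (s : ℝ) (hs : s < n) :
    ∫⁻ t, ENNReal.ofReal (t ^ (-s)) * ENNReal.ofReal (exp (-(t ^ p / p)) / wgtZ p ^ n) ∂(kap n) =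
      ENNReal.ofReal (n / wgtZ p ^ n * ((1 / p) ^ (-((n - s) / p)) * (1 / p) * Real.Gamma ((n - s) / p))) := by
  have hZ := wgtZ_pos p hp
  have h1 := integral_rpow_mul_exp_neg_mul_rpow (p := p) (q := n - s - 1) (b := 1 / p) (by linarith) (by linarith) (by positivity)
  have h2 := integrableOn_rpow_mul_exp_neg_mul_rpow (p := p) (s := n - s - 1) (b := 1 / p) (by linarith) (by linarith) (by positivity)
  unfold kap
  rw [lintegral_withDensity_eq_lintegral_mul _ (by fun_prop) (by fun_prop)]
  have e : ∀ t ∈ Set.Ioi (0 : ℝ), ((fun r : ℝ => ENNReal.ofReal (n * r ^ (n - 1))) * fun t : ℝ => ENNReal.ofReal (t ^ (-s)) * ENNReal.ofReal (exp (-(t ^ p / p)) / wgtZ p ^ n)) t =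
      ENNReal.ofReal (n / wgtZ p ^ n * (t ^ ((n : ℝ) - s - 1) * exp (-(1 / p) * t ^ p))) := by
    intro t ht
    have ht : 0 < t := ht
    simp only [Pi.mul_apply]
    rw [← ENNReal.ofReal_mul (by positivity), ← ENNReal.ofReal_mul (by positivity)]
    congr 1
    have : t ^ ((n : ℝ) - s - 1) = t ^ (n - 1) * t ^ (-s) := by
      rw [← Real.rpow_natCast, ← Real.rpow_add ht, Nat.cast_sub hn]; congr 1; push_cast; ring
    rw [this, show -(1 / p) * t ^ p = -(t ^ p / p) by ring]
    ring
  rw [setLIntegral_congr_fun measurableSet_Ioi e, ← ofReal_integral_eq_lintegral_ofReal (h2.const_mul _), integral_const_mul, h1]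
  · congr 3
    · congr 2
      ring
    · congr 1; ring
  · filter_upwards [ae_restrict_mem measurableSet_Ioi] with t ht
    have ht : 0 < t := ht
    simp only [Pi.zero_apply]
    positivity

theorem pi_polar (p : ℝ) (hp : 2 ≤ p) (n : ℕ) (hn : 0 < n) (s : ℝ) (hs : s < n)
    (h : (Fin n → ℝ) → ENNReal) (hh : Measurable h) :
    ∫⁻ x : Fin n → ℝ, h ((lpNorm p x)⁻¹ • x) * ENNReal.ofReal (lpNorm p x ^ (-s)) ∂(Measure.pi (fun _ : Fin n => nuMeasure p)) =
      (∫⁻ x, h x ∂(coneMeasure p n)) * (volume {x : Fin n → ℝ | lpNorm p x ≤ 1} * 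
        ENNReal.ofReal (n / wgtZ p ^ n * ((1 / p) ^ (-((n - s) / p)) * (1 / p) * Real.Gamma ((n - s) / p)))) := by
  have hNm := (lpNorm_cont p hp n).measurable
  have hm : Measurable (fun x : Fin n → ℝ => h ((lpNorm p x)⁻¹ • x) * ENNReal.ofReal (lpNorm p x ^ (-s))) :=
    (hh.comp (theta_meas p hp n)).mul (by fun_prop)
  rw [← radial_val p hp n hn s hs, ← polar_lint p hp n hn h hh _ (by fun_prop), pi_density p hp n,
    lintegral_withDensity_eq_lintegral_mul _ (by fun_prop) hm]
  apply lintegral_congr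
  intro x
  simp only [Pi.mul_apply]
  ring

theorem pi_polar_zero (p : ℝ) (hp : 2 ≤ p) (n : ℕ) (hn : 0 < n) :
    volume {x : Fin n → ℝ | lpNorm p x ≤ 1} * 
        ENNReal.ofReal (n / wgtZ p ^ n * ((1 / p) ^ (-((n : ℝ) / p)) * (1 / p) * Real.Gamma ((n : ℝ) / p))) = 1 := by
  have := nu_prob p hp
  have := cone_prob p hp n hn
  have h := pi_polar p hp n hn 0 (by exact_mod_cast hn) (fun _ => 1) measurable_const
  simpa using h.symm

theorem pi_map (p : ℝ) (hp : 2 ≤ p) (n : ℕ) (hn : 0 < n) :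
    Measure.map (fun x : Fin n → ℝ => (lpNorm p x)⁻¹ • x) (Measure.pi (fun _ : Fin n => nuMeasure p)) = coneMeasure p n := by
  apply Measure.ext_of_lintegral
  intro h hh
  rw [lintegral_map hh (theta_meas p hp n)]
  have := pi_polar p hp n hn 0 (by exact_mod_cast hn) h hh
  simp only [sub_zero] at this
  rw [pi_polar_zero p hp n hn] at this
  simpa using this

theorem pi_polar_q (p : ℝ) (hp : 2 ≤ p) (n : ℕ) (hn : 0 < n) (q : ℝ) (hs : q < n)
    (h : (Fin n → ℝ) → ENNReal) (hh : Measurable h) :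
    ∫⁻ x : Fin n → ℝ, h ((lpNorm p x)⁻¹ • x) * ENNReal.ofReal (lpNorm p x ^ (-q)) ∂(Measure.pi (fun _ : Fin n => nuMeasure p)) =
      (∫⁻ x, h x ∂(coneMeasure p n)) *
        ENNReal.ofReal (Real.Gamma (((n : ℝ) - q) / p) / (p ^ (q / p) * Real.Gamma ((n : ℝ) / p))) := by
  have hZ := wgtZ_pos p hp
  have hn' : (0 : ℝ) < n := by exact_mod_cast hn
  have hp0 : 0 < p := by linarith
  have hG : 0 < Real.Gamma ((n : ℝ) / p) := Real.Gamma_pos_of_pos (by positivity)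
  have hG' : 0 < Real.Gamma (((n : ℝ) - q) / p) := Real.Gamma_pos_of_pos (div_pos (by linarith) hp0)
  rw [pi_polar p hp n hn q hs h hh]
  congr 1
  have h0 := pi_polar_zero p hp n hn
  have e : (n / wgtZ p ^ n * ((1 / p) ^ (-(((n : ℝ) - q) / p)) * (1 / p) * Real.Gamma (((n : ℝ) - q) / p))) =
      (n / wgtZ p ^ n * ((1 / p) ^ (-((n : ℝ) / p)) * (1 / p) * Real.Gamma ((n : ℝ) / p))) *
      (Real.Gamma (((n : ℝ) - q) / p) / (p ^ (q / p) * Real.Gamma ((n : ℝ) / p))) := by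
    have : (1 / p) ^ (-(((n : ℝ) - q) / p)) = (1 / p) ^ (-((n : ℝ) / p)) / p ^ (q / p) := by
      rw [show -(((n : ℝ) - q) / p) = -((n : ℝ) / p) + q / p by ring, Real.rpow_add (by positivity),
        Real.div_rpow (by norm_num) hp0.le (q / p), Real.one_rpow]
      ring
    rw [this]
    have : 0 < p ^ (q / p) := by positivity
    field_simp
  rw [e, ENNReal.ofReal_mul (by positivity), ← mul_assoc, h0, one_mul]


theorem rpow_add_two (q : ℝ) (hq : 1 ≤ q) (u v : ℝ) (hu : 0 ≤ u) (hv : 0 ≤ v) :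
    (u + v) ^ q ≤ 2 ^ (q - 1) * (u ^ q + v ^ q) := by
  have := NNReal.rpow_add_le_mul_rpow_add_rpow ⟨u, hu⟩ ⟨v, hv⟩ hq
  exact_mod_cast this

theorem sum_bound (p : ℝ) (hp : 2 ≤ p) (q : ℝ) (hq : q = p / (p - 1)) (n : ℕ) (a t : Fin n → ℝ)
    (ht : ∑ i, |t i| ^ p = 1) (c : ℝ) (hc : 0 ≤ c) :
    ∑ i, (c * (|a i| + |∑ j, a j * t j| * |t i| ^ (p - 1))) ^ q ≤ c ^ q * 2 ^ q * ∑ i, |a i| ^ q := by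
  have hcj := aux_conj p hp q hq
  have hq1 : 1 < q := hcj.symm.lt
  have hpq : (p - 1) * q = p := by rw [hq]; field_simp [show p - 1 ≠ 0 by linarith]
  set b := ∑ j, a j * t j with hb
  have hA : 0 ≤ ∑ i, |a i| ^ q := Finset.sum_nonneg fun i _ => by positivity
  have hbb : |b| ^ q ≤ ∑ i, |a i| ^ q := by
    have h1 : |b| ≤ (∑ i, |a i| ^ q) ^ (1 / q) := by
      have h2 := Real.inner_le_Lp_mul_Lq Finset.univ (fun i => |a i|) (fun i => |t i|) hcj.symm
      simp only [abs_abs, ht, Real.one_rpow, mul_one] at h2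
      refine le_trans ?_ h2
      rw [hb]
      refine (Finset.abs_sum_le_sum_abs _ _).trans (le_of_eq ?_)
      simp_rw [abs_mul]
    calc |b| ^ q ≤ ((∑ i, |a i| ^ q) ^ (1 / q)) ^ q := by gcongr
      _ = _ := by rw [← Real.rpow_mul hA, one_div_mul_cancel (by linarith), Real.rpow_one]
  have hterm : ∀ i, (c * (|a i| + |b| * |t i| ^ (p - 1))) ^ q ≤ c ^ q * (2 ^ (q - 1) * (|a i| ^ q + |b| ^ q * |t i| ^ p)) := by
    intro i
    rw [Real.mul_rpow hc (by positivity)]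
    gcongr
    refine (rpow_add_two q hq1.le _ _ (by positivity) (by positivity)).trans (le_of_eq ?_)
    rw [Real.mul_rpow (by positivity) (by positivity), ← Real.rpow_mul (abs_nonneg _), hpq]
  refine (Finset.sum_le_sum fun i _ => hterm i).trans ?_
  rw [← Finset.mul_sum, ← Finset.mul_sum, Finset.sum_add_distrib, ← Finset.mul_sum, ht, mul_one, mul_assoc]
  refine mul_le_mul_of_nonneg_left ?_ (by positivity)
  have : (2 : ℝ) ^ q = 2 ^ (q - 1) * 2 := by
    rw [Real.rpow_sub_one (by norm_num)]; ring
  rw [this, mul_assoc]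
  gcongr
  linarith

theorem power_deriv_bound (q : ℝ) (hq : 1 < q) (F : ℝ → ℝ) (hF : ContDiff ℝ 1 F) (ε : ℝ) (hε : 0 < ε) :
    ∃ g' : ℝ → ℝ, Continuous g' ∧ (∀ t, HasDerivAt (fun t => |F t| ^ q + ε) (g' t) t) ∧
      ∀ t, |g' t| ^ q * (|F t| ^ q + ε) ^ (1 - q) ≤ q ^ q * |deriv F t| ^ q := by
  have hd : ∀ t, HasDerivAt (fun t => |F t| ^ q + ε) (q * |F t| ^ (q - 2) * F t * deriv F t) t := by
    intro t
    have h1 := (hF.differentiable one_ne_zero t).hasDerivAt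
    exact ((hasDerivAt_abs_rpow (F t) hq).comp t h1).add_const ε
  have hcd : ContDiff ℝ 1 (fun t => |F t| ^ q + ε) :=
    ((contDiff_norm_rpow (E := ℝ) hq).comp hF).add contDiff_const
  refine ⟨_, hcd.continuous_deriv_one, fun t => (hcd.differentiable one_ne_zero t).hasDerivAt, fun t => ?_⟩
  rw [(hd t).deriv]
  by_cases h0 : F t = 0
  · rw [h0]; simp only [mul_zero, zero_mul, abs_zero]
    rw [Real.zero_rpow (by linarith : q ≠ 0), zero_mul]; positivity
  · have hFp : 0 < |F t| := abs_pos.2 h0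
    have e1 : |q * |F t| ^ (q - 2) * F t * deriv F t| = q * |F t| ^ (q - 1) * |deriv F t| := by
      rw [abs_mul, abs_mul, abs_mul, abs_of_pos (by linarith : 0 < q), abs_of_pos (Real.rpow_pos_of_pos hFp _),
        mul_assoc q, ← Real.rpow_add_one hFp.ne']
      congr 3; ring
    have e2 : (|F t| ^ q + ε) ^ (1 - q) ≤ (|F t| ^ q) ^ (1 - q) :=
      Real.rpow_le_rpow_of_nonpos (by positivity) (by linarith) (by linarith)
    rw [e1]
    calc _ ≤ (q * |F t| ^ (q - 1) * |deriv F t|) ^ q * (|F t| ^ q) ^ (1 - q) := by gcongr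
      _ = q ^ q * |deriv F t| ^ q := by
        rw [Real.mul_rpow (by positivity) (by positivity), Real.mul_rpow (by positivity) (by positivity),
          ← Real.rpow_mul hFp.le, ← Real.rpow_mul hFp.le]
        have : |F t| ^ ((q - 1) * q) * |F t| ^ (q * (1 - q)) = 1 := by
          rw [← Real.rpow_add hFp]; ring_nf; simp
        linear_combination q ^ q * |deriv F t| ^ q * this

/-- the derivative of the norm along a coordinate line -/
theorem norm_line (p : ℝ) (hp : 2 ≤ p) {n : ℕ} (x : Fin n → ℝ) (i j : Fin n) (hij : j ≠ i) (hj : x j ≠ 0) :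
    ContDiff ℝ 1 (fun t => lpNorm p (Function.update x i t)) ∧ ∀ t,
      |deriv (fun t => lpNorm p (Function.update x i t)) t| ≤
       |((lpNorm p (Function.update x i t))⁻¹ • Function.update x i t) i| ^ (p - 1) := by
  have hp0 : 0 < p := by linarith
  set c := ∑ k ∈ Finset.univ.erase i, |x k| ^ p with hc
  have hc0 : 0 < c := by
    have : 0 < |x j| := abs_pos.2 hj
    exact Finset.sum_pos' (fun k _ => by positivity) ⟨j, by simp [hij], by positivity⟩
  have hN : ∀ t, lpNorm p (Function.update x i t) = (|t| ^ p + c) ^ (1 / p) := by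
    intro t
    unfold _root_.lpNorm
    rw [← Finset.add_sum_erase _ _ (Finset.mem_univ i), Function.update_self, hc]
    congr 2
    apply Finset.sum_congr rfl
    intro k hk
    rw [Function.update_of_ne (Finset.ne_of_mem_erase hk)]
  have hpos : ∀ t : ℝ, 0 < |t| ^ p + c := fun t => by positivity
  have h1 : ContDiff ℝ 1 (fun t : ℝ => |t| ^ p + c) :=
    (contDiff_norm_rpow (E := ℝ) (by linarith)).add contDiff_const
  constructor
  · simp_rw [hN]
    exact h1.rpow_const_of_ne (fun t => (hpos t).ne')
  · intro t
    have hd := ((hasDerivAt_abs_rpow t (by linarith : 1 < p)).add_const c).rpow_const (p := 1 / p) (Or.inl (hpos t).ne')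
    simp_rw [hN]
    rw [hd.deriv]
    have e0 : |((|t| ^ p + c) ^ (1 / p))⁻¹ * t| = ((|t| ^ p + c) ^ (1 / p))⁻¹ * |t| := by
      rw [abs_mul, abs_inv, abs_of_pos (Real.rpow_pos_of_pos (hpos t) _)]
    rw [Pi.smul_apply, Function.update_self, smul_eq_mul, e0,
      Real.mul_rpow (by positivity) (by positivity), Real.inv_rpow (by have := hpos t; positivity), ← Real.rpow_mul (hpos t).le,
      ← Real.rpow_neg (hpos t).le]
    rw [abs_mul, abs_mul, abs_mul, abs_mul, abs_of_pos hp0, abs_of_pos (by positivity : 0 < 1 / p),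
      abs_of_pos (Real.rpow_pos_of_pos (hpos t) _), abs_of_nonneg (by positivity : 0 ≤ |t| ^ (p - 2))]
    have e1 : |t| ^ (p - 2) * |t| = |t| ^ (p - 1) := by
      rcases eq_or_ne t 0 with rfl | h
      · simp [Real.zero_rpow (by linarith : p - 1 ≠ 0)]
      · rw [← Real.rpow_add_one (abs_pos.2 h).ne']; congr 1; ring
    have e2 : 1 / p - 1 = -(1 / p * (p - 1)) := by field_simp; ring
    rw [← e2, ← e1]
    apply le_of_eq
    field_simp

theorem theta_sphere (p : ℝ) (hp : 2 ≤ p) {n : ℕ} (x : Fin n → ℝ) (h : 0 < lpNorm p x) :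
    lpNorm p ((lpNorm p x)⁻¹ • x) = 1 := by
  rw [lpNorm_smul p hp, abs_of_pos (by positivity), inv_mul_cancel₀ h.ne']

theorem lin_sum {n : ℕ} (L : (Fin n → ℝ) →L[ℝ] ℝ) (y : Fin n → ℝ) : L y = ∑ k, L (Pi.single k 1) * y k := by
  conv_lhs => rw [← Finset.univ_sum_single y]
  rw [map_sum]
  apply Finset.sum_congr rfl
  intro k _
  have hk : (Pi.single k (y k) : Fin n → ℝ) = y k • Pi.single k 1 := by
    rw [← Pi.single_smul, smul_eq_mul, mul_one]
  rw [hk, map_smul, smul_eq_mul, mul_comm]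

theorem line_deriv (p : ℝ) (hp : 2 ≤ p) {n : ℕ} (x : Fin n → ℝ) (i j : Fin n) (hij : j ≠ i) (hj : x j ≠ 0)
    (f : (Fin n → ℝ) → ℝ) (U : Set (Fin n → ℝ)) (hU : IsOpen U)
    (hsub : {x : Fin n → ℝ | lpNorm p x = 1} ⊆ U) (hf : ContDiffOn ℝ 1 f U) :
    ContDiff ℝ 1 (fun t => f ((lpNorm p (Function.update x i t))⁻¹ • Function.update x i t)) ∧
    ∀ t y, y = (lpNorm p (Function.update x i t))⁻¹ • Function.update x i t → 
      |deriv (fun t => f ((lpNorm p (Function.update x i t))⁻¹ • Function.update x i t)) t| ≤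
      (lpNorm p (Function.update x i t))⁻¹ * (|fderiv ℝ f y (Pi.single i 1)| +
        |∑ k, fderiv ℝ f y (Pi.single k 1) * y k| * |y i| ^ (p - 1)) := by
  have hNpos : ∀ t, 0 < lpNorm p (Function.update x i t) := fun t =>
    lpNorm_pos p _ j (by rw [Function.update_of_ne hij]; exact hj)
  obtain ⟨hN, hN'⟩ := norm_line p hp x i j hij hj
  have hγ : ContDiff ℝ 1 (fun t => (lpNorm p (Function.update x i t))⁻¹ • Function.update x i t) :=
    (hN.inv (fun t => (hNpos t).ne')).smul (contDiff_update 1 x i)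
  have hγU : ∀ t, (lpNorm p (Function.update x i t))⁻¹ • Function.update x i t ∈ U := fun t =>
    hsub (theta_sphere p hp _ (hNpos t))
  refine ⟨hf.comp_contDiff hγ hγU, ?_⟩
  intro t y hy
  have hyU : y ∈ U := hy ▸ hγU t
  have hfd : HasFDerivAt f (fderiv ℝ f y) y :=
    ((hf.differentiableOn one_ne_zero).differentiableAt (hU.mem_nhds hyU)).hasFDerivAt
  have hNd := (hN.differentiable one_ne_zero t).hasDerivAt
  set N' := deriv (fun t => lpNorm p (Function.update x i t)) t with hN'def
  have hγd := (hNd.inv (hNpos t).ne').smul (hasDerivAt_update x i t)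
  have hcomp := HasFDerivAt.comp_hasDerivAt_of_eq t hfd hγd hy
  have hcomp' : HasDerivAt (fun t => f ((lpNorm p (Function.update x i t))⁻¹ • Function.update x i t)) _ t := hcomp
  rw [hcomp'.deriv]
  have hlin := lin_sum (fderiv ℝ f y) y
  have hup : Function.update x i t = lpNorm p (Function.update x i t) • y := by
    rw [hy, smul_smul, mul_inv_cancel₀ (hNpos t).ne', one_smul]
  have hb := hN' t
  rw [← hy] at hb
  set N := lpNorm p (Function.update x i t) with hNdef
  have hNp : 0 < N := hNpos t
  simp only [Pi.inv_apply]
  rw [← hNdef, map_add, map_smul, map_smul, hup, map_smul, hlin]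
  set b := ∑ k, fderiv ℝ f y (Pi.single k 1) * y k
  set a := fderiv ℝ f y (Pi.single i 1)
  simp only [smul_eq_mul]
  have : N⁻¹ * a + -N' / N ^ 2 * (N * b) = N⁻¹ * (a - b * N') := by
    field_simp
    ring
  rw [this, abs_mul, abs_of_pos (inv_pos.2 hNp)]
  gcongr
  refine (abs_sub _ _).trans ?_
  rw [abs_mul]
  gcongr


theorem coord_le (p : ℝ) (hp : 2 ≤ p) {n : ℕ} (x : Fin n → ℝ) (j : Fin n) : |x j| ≤ lpNorm p x := by
  have hp0 : 0 < p := by linarith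
  rw [← Real.rpow_le_rpow_iff (abs_nonneg _) (lpNorm_nonneg p x) hp0, lpNorm_pow p hp]
  exact Finset.single_le_sum (f := fun i => |x i| ^ p) (fun i _ => by positivity) (Finset.mem_univ j)

/-- the pointwise gradient bound -/
noncomputable def gradBd (p q : ℝ) {n : ℕ} (a : Fin n → (Fin n → ℝ) → ℝ) (i : Fin n) (x : Fin n → ℝ) : ℝ :=
  ((lpNorm p x)⁻¹ * (|a i ((lpNorm p x)⁻¹ • x)| +
    |∑ j, a j ((lpNorm p x)⁻¹ • x) * ((lpNorm p x)⁻¹ • x) j| * |((lpNorm p x)⁻¹ • x) i| ^ (p - 1))) ^ q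

theorem gradBd_nonneg (p q : ℝ) {n : ℕ} (a : Fin n → (Fin n → ℝ) → ℝ) (i : Fin n) (x : Fin n → ℝ) :
    0 ≤ gradBd p q a i x := by
  have := lpNorm_nonneg p x
  unfold gradBd; positivity

theorem gradBd_meas (p : ℝ) (hp : 2 ≤ p) (q : ℝ) {n : ℕ} (a : Fin n → (Fin n → ℝ) → ℝ) (ha : ∀ i, Measurable (a i)) (i : Fin n) :
    Measurable (gradBd p q a i) := by
  have hN := (lpNorm_cont p hp n).measurable
  have hθ := theta_meas p hp n
  have hai : ∀ i, Measurable (fun x : Fin n → ℝ => a i ((lpNorm p x)⁻¹ • x)) := fun i => (ha i).comp hθ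
  have hti : ∀ i, Measurable (fun x : Fin n → ℝ => ((lpNorm p x)⁻¹ • x) i) := fun i => (measurable_pi_apply i).comp hθ
  have hs : Measurable (fun x : Fin n → ℝ => ∑ j, a j ((lpNorm p x)⁻¹ • x) * ((lpNorm p x)⁻¹ • x) j) :=
    Finset.measurable_sum _ fun j _ => (hai j).mul (hti j)
  have habs : ∀ u : (Fin n → ℝ) → ℝ, Measurable u → Measurable (fun x => |u x|) := fun u hu =>
    continuous_abs.measurable.comp hu
  unfold gradBd
  exact (hN.inv.mul ((habs _ (hai i)).add ((habs _ hs).mul ((habs _ (hti i)).pow_const _)))).pow_const _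

theorem slice_ent (p : ℝ) (hp : 2 ≤ p) (q : ℝ) (hq : q = p / (p - 1)) {n : ℕ} (x : Fin n → ℝ) (i j : Fin n) (hij : j ≠ i) (hj : x j ≠ 0)
    (f : (Fin n → ℝ) → ℝ) (U : Set (Fin n → ℝ)) (hU : IsOpen U)
    (hsub : {x : Fin n → ℝ | lpNorm p x = 1} ⊆ U) (hf : ContDiffOn ℝ 1 f U)
    (f0 : (Fin n → ℝ) → ℝ) (a : Fin n → (Fin n → ℝ) → ℝ) (K : ℝ)
    (hf0 : ∀ z, lpNorm p z = 1 → f0 z = f z) (hfK : ∀ z, |f0 z| ≤ K)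
    (ha : ∀ i z, lpNorm p z = 1 → a i z = fderiv ℝ f z (Pi.single i 1)) (haK : ∀ i z, |a i z| ≤ K)
    (ham : ∀ i, Measurable (a i)) (ε : ℝ) (hε : 0 < ε) :
    ENNReal.ofReal (entropy (nuMeasure p) (fun s =>
      |f0 ((lpNorm p (Function.update x i s))⁻¹ • Function.update x i s)| ^ q + ε)) ≤
    ENNReal.ofReal (2 * q ^ (q - 1)) * ∫⁻ s, ENNReal.ofReal (gradBd p q a i (Function.update x i s)) ∂(nuMeasure p) := by
  have := nu_prob p hp
  have hq1 : 1 < q := (aux_conj p hp q hq).symm.lt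
  have hK : 0 ≤ K := (abs_nonneg _).trans (hfK 0)
  have hNpos : ∀ t, 0 < lpNorm p (Function.update x i t) := fun t =>
    lpNorm_pos p _ j (by rw [Function.update_of_ne hij]; exact hj)
  have hθ : ∀ t, lpNorm p ((lpNorm p (Function.update x i t))⁻¹ • Function.update x i t) = 1 := fun t =>
    theta_sphere p hp _ (hNpos t)
  obtain ⟨hF, hF'⟩ := line_deriv p hp x i j hij hj f U hU hsub hf
  have hfun : (fun s => |f0 ((lpNorm p (Function.update x i s))⁻¹ • Function.update x i s)| ^ q + ε) =
    (fun s => |f ((lpNorm p (Function.update x i s))⁻¹ • Function.update x i s)| ^ q + ε) := by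
    ext s; rw [hf0 _ (hθ s)]
  obtain ⟨g', hg'c, hg'd, hg'b⟩ := power_deriv_bound q hq1 _ hF ε hε
  have hm : Measurable (fun s => gradBd p q a i (Function.update x i s)) :=
    (gradBd_meas p hp q a ham i).comp (measurable_update x)
  have hint : Integrable (fun s => gradBd p q a i (Function.update x i s)) (nuMeasure p) := by
    refine bdd_integrable _ _ hm ((|x j|⁻¹ * (K + (∑ k : Fin n, K * 1) * 1 ^ (p - 1))) ^ q) (fun s => ?_)
    rw [abs_of_nonneg (gradBd_nonneg _ _ _ _ _)]
    unfold gradBd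
    have h1 : |x j| ≤ lpNorm p (Function.update x i s) := by
      have := coord_le p hp (Function.update x i s) j
      rwa [Function.update_of_ne hij] at this
    have h0 : 0 < |x j| := abs_pos.2 hj
    have h2 : ∀ k, |((lpNorm p (Function.update x i s))⁻¹ • Function.update x i s) k| ≤ 1 := by
      intro k; rw [← hθ s]; exact coord_le p hp _ k
    have h3 : |∑ k, a k ((lpNorm p (Function.update x i s))⁻¹ • Function.update x i s) *
        ((lpNorm p (Function.update x i s))⁻¹ • Function.update x i s) k| ≤ ∑ k : Fin n, K * 1 := by
      refine (Finset.abs_sum_le_sum_abs _ _).trans (Finset.sum_le_sum fun k _ => ?_)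
      rw [abs_mul]
      exact mul_le_mul (haK k _) (h2 k) (abs_nonneg _) hK
    have h4 := hNpos s
    have h5 : 0 ≤ ∑ k : Fin n, K * 1 := Finset.sum_nonneg fun k _ => by positivity
    have h6 : 0 ≤ p - 1 := by linarith
    have h7 := haK i ((lpNorm p (Function.update x i s))⁻¹ • Function.update x i s)
    have h8 := h2 i
    gcongr
  have hmain := aux_real p hp q hq _ g' hg'd hg'c ε (K ^ q + ε) hε
    (fun s => by have : 0 ≤ |f ((lpNorm p (Function.update x i s))⁻¹ • Function.update x i s)| ^ q := by positivity
                 linarith)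
    (fun s => by
      have : |f ((lpNorm p (Function.update x i s))⁻¹ • Function.update x i s)| ≤ K := by
        rw [← hf0 _ (hθ s)]; exact hfK _
      gcongr)
    (fun s => q ^ q * gradBd p q a i (Function.update x i s)) (hint.const_mul _)
    (fun s => by
      refine (hg'b s).trans ?_
      have h1 := hF' s _ rfl
      have h2 : ∀ k, fderiv ℝ f ((lpNorm p (Function.update x i s))⁻¹ • Function.update x i s) (Pi.single k 1) =
        a k ((lpNorm p (Function.update x i s))⁻¹ • Function.update x i s) := fun k => (ha k _ (hθ s)).symm
      simp only [h2] at h1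
      unfold gradBd
      gcongr)
  rw [hfun, ← ofReal_integral_eq_lintegral_ofReal hint (Filter.Eventually.of_forall fun s => gradBd_nonneg _ _ _ _ _),
    ← ENNReal.ofReal_mul (by positivity)]
  apply ENNReal.ofReal_le_ofReal
  refine hmain.trans (le_of_eq ?_)
  rw [integral_const_mul, ← mul_assoc, Real.rpow_sub_one (by linarith)]
  field_simp

theorem pi_ae_ne (p : ℝ) (hp : 2 ≤ p) (n : ℕ) : ∀ᵐ x ∂(Measure.pi (fun _ : Fin n => nuMeasure p)), ∀ j, x j ≠ 0 := by
  have := nu_prob p hp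
  have : NullSingletonClass (nuMeasure p) :=
    ⟨fun x => withDensity_absolutelyContinuous _ _ (measure_singleton x)⟩
  rw [ae_all_iff]
  intro j
  exact measure_eq_zero_iff_ae_notMem.1 (Measure.pi_hyperplane (fun _ : Fin n => nuMeasure p) j 0)

theorem pi_ent (p : ℝ) (hp : 2 ≤ p) (q : ℝ) (hq : q = p / (p - 1)) (n : ℕ) (hn : q < n)
    (f : (Fin n → ℝ) → ℝ) (U : Set (Fin n → ℝ)) (hU : IsOpen U)
    (hsub : {x : Fin n → ℝ | lpNorm p x = 1} ⊆ U) (hf : ContDiffOn ℝ 1 f U)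
    (f0 : (Fin n → ℝ) → ℝ) (a : Fin n → (Fin n → ℝ) → ℝ) (K : ℝ)
    (hf0 : ∀ z, lpNorm p z = 1 → f0 z = f z) (hfK : ∀ z, |f0 z| ≤ K)
    (ha : ∀ i z, lpNorm p z = 1 → a i z = fderiv ℝ f z (Pi.single i 1)) (haK : ∀ i z, |a i z| ≤ K)
    (hfm : Measurable f0) (ham : ∀ i, Measurable (a i)) (ε : ℝ) (hε : 0 < ε) :
    entropy (Measure.pi (fun _ : Fin n => nuMeasure p)) (fun x => |f0 ((lpNorm p x)⁻¹ • x)| ^ q + ε) ≤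
      4 ^ q * q ^ (q - 1) *
        (Real.Gamma (((n : ℝ) - q) / p) / (p ^ (q / p) * Real.Gamma ((n : ℝ) / p))) *
        ∫ x, ∑ i, |a i x| ^ q ∂(coneMeasure p n) := by
  have := nu_prob p hp
  have hp0 : 0 < p := by linarith
  have hq1 : 1 < q := (aux_conj p hp q hq).symm.lt
  have hK : 0 ≤ K := (abs_nonneg _).trans (hfK 0)
  have hn1 : 1 < n := by
    have : (1 : ℝ) < n := hq1.trans hn
    exact_mod_cast this
  have hnt : Nontrivial (Fin n) := Fin.nontrivial_iff_two_le.2 hn1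
  have := cone_prob p hp n (by omega)
  have hθ := theta_meas p hp n
  have habs : ∀ u : (Fin n → ℝ) → ℝ, Measurable u → Measurable (fun x => |u x|) := fun u hu =>
    continuous_abs.measurable.comp hu
  have hGm : Measurable (fun x : Fin n → ℝ => |f0 ((lpNorm p x)⁻¹ • x)| ^ q + ε) :=
    ((habs _ (hfm.comp hθ)).pow_const q).add_const ε
  have hSm : Measurable (fun x : Fin n → ℝ => ∑ i, |a i x| ^ q) :=
    Finset.measurable_sum _ fun i _ => (habs _ (ham i)).pow_const q
  have hS0 : ∀ x, 0 ≤ ∑ i, |a i x| ^ q := fun x => Finset.sum_nonneg fun i _ => by positivity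
  have hSint : Integrable (fun x => ∑ i, |a i x| ^ q) (coneMeasure p n) := by
    refine bdd_integrable _ _ hSm (∑ i : Fin n, K ^ q) (fun x => ?_)
    rw [abs_of_nonneg (hS0 x)]
    refine Finset.sum_le_sum fun i _ => ?_
    have := haK i x
    gcongr
  have hG0 : 0 < Real.Gamma ((n : ℝ) / p) := Real.Gamma_pos_of_pos (div_pos (by linarith) hp0)
  have hG1 : 0 < Real.Gamma (((n : ℝ) - q) / p) := Real.Gamma_pos_of_pos (div_pos (by linarith) hp0)
  set Γc := Real.Gamma (((n : ℝ) - q) / p) / (p ^ (q / p) * Real.Gamma ((n : ℝ) / p)) with hΓ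
  have hΓ0 : 0 ≤ Γc := by positivity
  have hI0 : 0 ≤ ∫ x, ∑ i, |a i x| ^ q ∂(coneMeasure p n) := integral_nonneg hS0
  have step1 := ent_tensor (nuMeasure p) n _ hGm ε (K ^ q + ε) hε (fun x => by
    have h1 := hfK ((lpNorm p x)⁻¹ • x)
    constructor
    · have : 0 ≤ |f0 ((lpNorm p x)⁻¹ • x)| ^ q := by positivity
      linarith
    · gcongr)
  have step2 : ∀ i, ∫⁻ x, ENNReal.ofReal (entropy (nuMeasure p) (fun s =>
      |f0 ((lpNorm p (Function.update x i s))⁻¹ • Function.update x i s)| ^ q + ε)) ∂(Measure.pi fun _ : Fin n => nuMeasure p) ≤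
      ENNReal.ofReal (2 * q ^ (q - 1)) * ∫⁻ x, ENNReal.ofReal (gradBd p q a i x) ∂(Measure.pi fun _ : Fin n => nuMeasure p) := by
    intro i
    obtain ⟨j, hij⟩ := exists_ne i
    rw [← lint_resample (nuMeasure p) n i _ (gradBd_meas p hp q a ham i).ennreal_ofReal,
      ← lintegral_const_mul' _ _ ENNReal.ofReal_ne_top]
    apply lintegral_mono_ae
    filter_upwards [pi_ae_ne p hp n] with x hx
    exact slice_ent p hp q hq x i j hij (hx j) f U hU hsub hf f0 a K hf0 hfK ha haK ham ε hε
  have step3 : ∑ i, ∫⁻ x, ENNReal.ofReal (gradBd p q a i x) ∂(Measure.pi fun _ : Fin n => nuMeasure p) ≤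
      ENNReal.ofReal (2 ^ q) * (ENNReal.ofReal (∫ x, ∑ i, |a i x| ^ q ∂(coneMeasure p n)) * ENNReal.ofReal Γc) := by
    rw [← lintegral_finset_sum _ (fun i _ => (gradBd_meas p hp q a ham i).ennreal_ofReal)]
    rw [ofReal_integral_eq_lintegral_ofReal hSint (Filter.Eventually.of_forall hS0),
      ← pi_polar_q p hp n (by omega) q hn _ hSm.ennreal_ofReal, ← lintegral_const_mul' _ _ ENNReal.ofReal_ne_top]
    apply lintegral_mono_ae
    filter_upwards [pi_ae_ne p hp n] with x hx
    have hN : 0 < lpNorm p x := lpNorm_pos p x ⟨0, by omega⟩ (hx _)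
    have hs := theta_sphere p hp x hN
    have hs1 : ∑ i, |((lpNorm p x)⁻¹ • x) i| ^ p = 1 := by rw [← lpNorm_pow p hp, hs, Real.one_rpow]
    rw [← ENNReal.ofReal_sum_of_nonneg (fun i _ => gradBd_nonneg _ _ _ _ _),
      ← ENNReal.ofReal_mul (hS0 _), ← ENNReal.ofReal_mul (by positivity)]
    apply ENNReal.ofReal_le_ofReal
    have := sum_bound p hp q hq n (fun i => a i ((lpNorm p x)⁻¹ • x)) _ hs1 (lpNorm p x)⁻¹ (by positivity)
    refine this.trans (le_of_eq ?_)
    rw [Real.rpow_neg hN.le, Real.inv_rpow hN.le]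
    ring
  have step4 : ENNReal.ofReal (entropy (Measure.pi (fun _ : Fin n => nuMeasure p)) (fun x => |f0 ((lpNorm p x)⁻¹ • x)| ^ q + ε)) ≤
      ENNReal.ofReal (2 * q ^ (q - 1)) * (ENNReal.ofReal (2 ^ q) * (ENNReal.ofReal (∫ x, ∑ i, |a i x| ^ q ∂(coneMeasure p n)) * ENNReal.ofReal Γc)) := by
    refine step1.trans ((Finset.sum_le_sum fun i _ => step2 i).trans ?_)
    rw [← Finset.mul_sum]
    gcongr
  rw [← ENNReal.ofReal_mul hI0, ← ENNReal.ofReal_mul (by positivity), ← ENNReal.ofReal_mul (by positivity),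
    ENNReal.ofReal_le_ofReal_iff (by positivity)] at step4
  refine step4.trans ?_
  have h4 : (4 : ℝ) ^ q = 2 ^ q * 2 ^ q := by
    rw [← Real.mul_rpow (by norm_num) (by norm_num)]; norm_num
  have h2 : (2 : ℝ) ≤ 2 ^ q := by
    conv_lhs => rw [← Real.rpow_one 2]
    exact Real.rpow_le_rpow_of_exponent_le (by norm_num) hq1.le
  rw [h4]
  calc _ = 2 * (2 ^ q * (q ^ (q - 1) * Γc * ∫ x, ∑ i, |a i x| ^ q ∂(coneMeasure p n))) := by ring
    _ ≤ 2 ^ q * (2 ^ q * (q ^ (q - 1) * Γc * ∫ x, ∑ i, |a i x| ^ q ∂(coneMeasure p n))) := by gcongr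
    _ = _ := by ring

theorem ent_limit {α : Type*} [MeasurableSpace α] (μ : Measure α) [IsProbabilityMeasure μ] (h : α → ℝ) (hm : Measurable h)
    (M : ℝ) (h0 : ∀ x, 0 ≤ h x) (hM : ∀ x, h x ≤ M) (R : ℝ)
    (hR : ∀ ε : ℝ, 0 < ε → entropy μ (fun x => h x + ε) ≤ R) : entropy μ h ≤ R := by
  obtain ⟨C, hC⟩ := (isCompact_Icc (a := (0 : ℝ)) (b := M + 1)).exists_bound_of_continuousOn
      (f := fun t : ℝ => t * log t) Real.continuous_mul_log.continuousOn
  have hint : Integrable h μ := bdd_integrable μ h hm M (fun x => by rw [abs_of_nonneg (h0 x)]; exact hM x)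
  have hI : Filter.Tendsto (fun ε : ℝ => ∫ x, (h x + ε) ∂μ) (nhdsWithin 0 (Set.Ioi 0)) (nhds (∫ x, h x ∂μ)) := by
    have : ∀ ε : ℝ, ∫ x, (h x + ε) ∂μ = (∫ x, h x ∂μ) + ε := fun ε => by
      rw [integral_add hint (integrable_const ε)]; simp
    simp_rw [this]
    have hc : Continuous (fun ε : ℝ => (∫ x, h x ∂μ) + ε) := by fun_prop
    have := hc.tendsto 0
    rw [add_zero] at this
    exact this.mono_left nhdsWithin_le_nhds
  have hL : Filter.Tendsto (fun ε : ℝ => ∫ x, (h x + ε) * log (h x + ε) ∂μ) (nhdsWithin 0 (Set.Ioi 0))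
      (nhds (∫ x, h x * log (h x) ∂μ)) := by
    apply tendsto_integral_filter_of_dominated_convergence (fun _ => C)
    · refine Filter.Eventually.of_forall fun ε => ?_
      exact (Real.continuous_mul_log.measurable.comp (hm.add_const ε)).aestronglyMeasurable
    · have : Set.Ioo (0 : ℝ) 1 ∈ nhdsWithin (0 : ℝ) (Set.Ioi 0) := Ioo_mem_nhdsGT one_pos
      filter_upwards [this] with ε hε
      refine Filter.Eventually.of_forall fun x => ?_
      exact hC (h x + ε) ⟨by linarith [h0 x, hε.1], by linarith [hM x, hε.2]⟩
    · exact integrable_const C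
    · refine Filter.Eventually.of_forall fun x => ?_
      have hc : Continuous (fun ε : ℝ => (h x + ε) * log (h x + ε)) :=
        Real.continuous_mul_log.comp (continuous_const.add continuous_id)
      have := hc.tendsto 0
      simp only [add_zero] at this
      exact this.mono_left nhdsWithin_le_nhds
  have hE : Filter.Tendsto (fun ε : ℝ => entropy μ (fun x => h x + ε)) (nhdsWithin 0 (Set.Ioi 0)) (nhds (entropy μ h)) := by
    unfold entropy
    exact hL.sub ((Real.continuous_mul_log.tendsto _).comp hI)
  exact le_of_tendsto hE (by filter_upwards [self_mem_nhdsWithin] with ε hε using hR ε hε)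

theorem ent_congr {α : Type*} [MeasurableSpace α] (μ : Measure α) (g h : α → ℝ) (hgh : g =ᵐ[μ] h) :
    entropy μ g = entropy μ h := by
  unfold entropy
  rw [integral_congr_ae hgh, integral_congr_ae (f := fun x => g x * log (g x)) (g := fun x => h x * log (h x))]
  filter_upwards [hgh] with x hx
  rw [hx]

theorem sphere_compact (p : ℝ) (hp : 2 ≤ p) (n : ℕ) : IsCompact {x : Fin n → ℝ | lpNorm p x = 1} := by
  apply Metric.isCompact_of_isClosed_isBounded (isClosed_eq (lpNorm_cont p hp n) continuous_const)
  refine (Metric.isBounded_closedBall (x := (0 : Fin n → ℝ)) (r := 1)).subset ?_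
  intro x hx
  rw [mem_closedBall_zero_iff, pi_norm_le_iff_of_nonneg zero_le_one]
  intro i
  have hx : lpNorm p x = 1 := hx
  rw [← hx]
  exact coord_le p hp x i

theorem cone_ae (p : ℝ) (hp : 2 ≤ p) (n : ℕ) (hn : 0 < n) : ∀ᵐ z ∂(coneMeasure p n), lpNorm p z = 1 := by
  rw [← pi_map p hp n hn, ae_map_iff (theta_meas p hp n).aemeasurable
    (measurableSet_eq_fun (lpNorm_cont p hp n).measurable measurable_const)]
  filter_upwards [pi_ae_ne p hp n] with x hx
  exact theta_sphere p hp x (lpNorm_pos p x ⟨0, hn⟩ (hx _))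

theorem cont_indicator {n : ℕ} (S : Set (Fin n → ℝ)) (hS : IsCompact S) (u : (Fin n → ℝ) → ℝ) (hu : ContinuousOn u S) :
    Measurable (S.indicator u) ∧ ∃ K, ∀ z, |S.indicator u z| ≤ K := by
  constructor
  · classical
    rw [← Set.piecewise_eq_indicator]
    exact hu.measurable_piecewise continuousOn_const hS.measurableSet
  · obtain ⟨K, hK⟩ := hS.exists_bound_of_continuousOn hu
    refine ⟨|K|, fun z => ?_⟩
    by_cases hz : z ∈ S
    · rw [Set.indicator_of_mem hz]; exact (hK z hz).trans (le_abs_self K)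
    · rw [Set.indicator_of_notMem hz, abs_zero]; exact abs_nonneg K

theorem lsq_first (p : ℝ) (hp : 2 ≤ p) (q : ℝ) (hq : q = p / (p - 1))
    (n : ℕ) (hn : q < (n : ℝ))
    (f : (Fin n → ℝ) → ℝ) (U : Set (Fin n → ℝ)) (hU : IsOpen U)
    (hsub : {x : Fin n → ℝ | lpNorm p x = 1} ⊆ U) (hf : ContDiffOn ℝ 1 f U) :
    entropy (coneMeasure p n) (fun x => |f x| ^ q) ≤
      4 ^ q * q ^ (q - 1) *
        (Real.Gamma (((n : ℝ) - q) / p) / (p ^ (q / p) * Real.Gamma ((n : ℝ) / p))) *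
        ∫ x, ∑ i, |fderiv ℝ f x (Pi.single i 1)| ^ q ∂(coneMeasure p n) := by
  have hq1 : 1 < q := (aux_conj p hp q hq).symm.lt
  have hn0 : 0 < n := by
    have : (0 : ℝ) < n := by linarith
    exact_mod_cast this
  have := cone_prob p hp n hn0
  set S := {x : Fin n → ℝ | lpNorm p x = 1} with hS
  have hSc : IsCompact S := sphere_compact p hp n
  obtain ⟨hfm, K0, hK0⟩ := cont_indicator S hSc f (hf.continuousOn.mono hsub)
  have hfd : ContinuousOn (fderiv ℝ f) U := hf.continuousOn_fderiv_of_isOpen hU le_rfl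
  have hai : ∀ i : Fin n, ContinuousOn (fun z => fderiv ℝ f z (Pi.single i 1)) S := fun i =>
    (hfd.mono hsub).clm_apply continuousOn_const
  choose ham K1 hK1 using fun i => cont_indicator S hSc _ (hai i)
  have hK00 : 0 ≤ K0 := (abs_nonneg _).trans (hK0 0)
  have hK10 : ∀ i, 0 ≤ K1 i := fun i => (abs_nonneg _).trans (hK1 i 0)
  have hK : ∀ i, K1 i ≤ ∑ i, K1 i := fun i => Finset.single_le_sum (fun i _ => hK10 i) (Finset.mem_univ i)
  have hKs : 0 ≤ ∑ i, K1 i := Finset.sum_nonneg fun i _ => hK10 i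
  have hae := cone_ae p hp n hn0
  have e1 : entropy (coneMeasure p n) (fun x => |f x| ^ q) = entropy (coneMeasure p n) (fun x => |S.indicator f x| ^ q) := by
    apply ent_congr
    filter_upwards [hae] with z hz
    rw [Set.indicator_of_mem (show z ∈ S from hz)]
  have e2 : ∫ x, ∑ i, |fderiv ℝ f x (Pi.single i 1)| ^ q ∂(coneMeasure p n) =
      ∫ x, ∑ i, |S.indicator (fun z => fderiv ℝ f z (Pi.single i 1)) x| ^ q ∂(coneMeasure p n) := by
    apply integral_congr_ae
    filter_upwards [hae] with z hz
    apply Finset.sum_congr rfl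
    intro i _
    rw [Set.indicator_of_mem (show z ∈ S from hz)]
  rw [e1, e2]
  have hhm : Measurable (fun x => |S.indicator f x| ^ q) := (continuous_abs.measurable.comp hfm).pow_const q
  apply ent_limit (coneMeasure p n) _ hhm (K0 ^ q) (fun x => by positivity) (fun x => by
    have := hK0 x
    gcongr)
  intro ε hε
  have hpi := pi_ent p hp q hq n hn f U hU hsub hf (S.indicator f)
    (fun i => S.indicator (fun z => fderiv ℝ f z (Pi.single i 1))) (K0 + ∑ i, K1 i)
    (fun z hz => Set.indicator_of_mem (show z ∈ S from hz) _) (fun z => (hK0 z).trans (by linarith))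
    (fun i z hz => Set.indicator_of_mem (show z ∈ S from hz) _) (fun i z => (hK1 i z).trans (by linarith [hK i]))
    hfm ham ε hε
  refine le_trans (le_of_eq ?_) hpi
  unfold entropy
  have hθ := theta_meas p hp n
  have hm1 : Measurable (fun x => |S.indicator f x| ^ q + ε) := hhm.add_const ε
  have hm2 : Measurable (fun x => (|S.indicator f x| ^ q + ε) * log (|S.indicator f x| ^ q + ε)) :=
    Real.continuous_mul_log.measurable.comp hm1
  rw [← pi_map p hp n hn0, integral_map hθ.aemeasurable hm1.aestronglyMeasurable,
    integral_map hθ.aemeasurable hm2.aestronglyMeasurable]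

/-- Theorem 4.1: the cone measure `μ_{p,n}` on the `ℓ_p`-sphere satisfies an
`LS_q`-inequality with constant of order `n^{-1/(p-1)}` (stated for the Euclidean gradient
of a function which is smooth in a neighbourhood of the sphere). -/
theorem lsq_cone_measure (p : ℝ) (hp : 2 ≤ p) (q : ℝ) (hq : q = p / (p - 1))
    (n : ℕ) (hn : q < (n : ℝ))
    (f : (Fin n → ℝ) → ℝ) (U : Set (Fin n → ℝ)) (hU : IsOpen U)
    (hsub : {x : Fin n → ℝ | lpNorm p x = 1} ⊆ U) (hf : ContDiffOn ℝ (⊤ : ℕ∞) f U) :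
    entropy (coneMeasure p n) (fun x => |f x| ^ q) ≤
      4 ^ q * q ^ (q - 1) *
        (Real.Gamma (((n : ℝ) - q) / p) / (p ^ (q / p) * Real.Gamma ((n : ℝ) / p))) *
        ∫ x, ∑ i, |fderiv ℝ f x (Pi.single i 1)| ^ q ∂(coneMeasure p n) ∧
    (3 ≤ n →
      4 ^ q * q ^ (q - 1) *
          (Real.Gamma (((n : ℝ) - q) / p) / (p ^ (q / p) * Real.Gamma ((n : ℝ) / p))) ≤
        3 * 4 ^ q * q ^ (q - 1) * (n : ℝ) ^ (-(1 / (p - 1)))) := by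
  exact ⟨lsq_first p hp q hq n hn f U hU hsub (hf.of_le (by exact_mod_cast le_top)), fun h3 => aux_gamma p hp q hq n hn h3⟩
end
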